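/- arXiv:2106.11247 — 4 statements merged into one kernel-verified Lean document; each statement's English description precedes it below -/
import Mathlib

section
/- Let x, y, z, p be four distinct points in ℝ² with x, y, z not collinear. Then p lies in the interior of the triangle conv{x, y, z} if and only if ∇xyz = ∇xyp = ∇xpz = ∇pyz. -/
open scoped Classical

noncomputable section

/-- Determinant of the pair of vectors `(q - p, r - p)`. -/
def orientDet (p q r : ℝ × ℝ) : ℝ :=
  (q.1 - p.1) * (r.2 - p.2) - (q.2 - p.2) * (r.1 - p.1)

/-- The orientation `∇ p q r` : `+1` for counterclockwise, `-1` for clockwise, `0` collinear. -/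
def orient (p q r : ℝ × ℝ) : ℝ := Real.sign (orientDet p q r)

/-- A set of points is in general position if no three of its points are collinear. -/
def GenPos (C : Set (ℝ × ℝ)) : Prop :=
  ∀ p ∈ C, ∀ q ∈ C, ∀ r ∈ C, p ≠ q → p ≠ r → q ≠ r → orientDet p q r ≠ 0

/-- The extremal points of a finite set `C`. -/
def exPts (C : Finset (ℝ × ℝ)) : Finset (ℝ × ℝ) :=
  C.filter (fun c => c ∉ convexHull ℝ ((C.erase c : Finset (ℝ × ℝ)) : Set (ℝ × ℝ)))

/-- The minimax value (Bob's total, Alice to move) of the convex grabbing game. -/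
def gameM (w : ℝ × ℝ → ℕ) (C : Finset (ℝ × ℝ)) : ℕ :=
  if h : C.card ≤ 1 then 0
  else
    sInf (↑((exPts C).attach.image (fun a =>
      (exPts (C.erase a.1)).attach.sup (fun b =>
        w b.1 + gameM w ((C.erase a.1).erase b.1)))) : Set ℕ)
termination_by C.card
decreasing_by
  have ha : a.1 ∈ C := Finset.mem_of_mem_filter _ a.2
  have hb : b.1 ∈ C.erase a.1 := Finset.mem_of_mem_filter _ b.2
  calc ((C.erase a.1).erase b.1).card
      < (C.erase a.1).card := Finset.card_erase_lt_of_mem hb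
    _ ≤ C.card := Finset.card_erase_le

/-- The minimax value of the game when it is Bob's turn to move. -/
def gameMB (w : ℝ × ℝ → ℕ) (C : Finset (ℝ × ℝ)) : ℕ :=
  (exPts C).sup (fun b => w b + gameM w (C.erase b))


theorem affineIndependent_of_orientDet_ne_zero {x y z : ℝ × ℝ} (h : orientDet x y z ≠ 0) :
    AffineIndependent ℝ ![x, y, z] := by
  rw [affineIndependent_iff_of_fintype]
  intro w hw hsum
  rw [Finset.univ.weightedVSub_eq_linear_combination hw] at hsum
  simp only [Fin.sum_univ_three, Prod.ext_iff] at hw hsum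
  simp at hw hsum
  obtain ⟨h₁, h₂⟩ := hsum
  have hw₁ : w 1 = 0 := by
    refine (mul_eq_zero.mp ?_).resolve_right h
    unfold orientDet
    linear_combination (z.2 - x.2) * h₁ - (z.1 - x.1) * h₂ +
      (x.2 * z.1 - x.1 * z.2) * hw
  have hw₂ : w 2 = 0 := by
    refine (mul_eq_zero.mp ?_).resolve_right h
    unfold orientDet
    linear_combination (y.1 - x.1) * h₂ - (y.2 - x.2) * h₁ +
      (x.1 * y.2 - x.2 * y.1) * hw
  have hw₀ : w 0 = 0 := by linarith
  intro i
  fin_cases i <;> assumption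

theorem sign_eq_sign_mul_iff {d c : ℝ} (hd : d ≠ 0) :
    Real.sign d = Real.sign (c * d) ↔ 0 < c := by
  rcases hd.lt_or_gt with hd | hd <;> rcases lt_trichotomy c 0 with hc | rfl | hc
  · rw [Real.sign_of_neg hd, Real.sign_of_pos (mul_pos_of_neg_of_neg hc hd)]
    norm_num [hc.le]
  · simp [Real.sign_of_neg hd]
  · simp [Real.sign_of_neg hd, Real.sign_of_neg (mul_neg_of_pos_of_neg hc hd), hc]
  · rw [Real.sign_of_pos hd, Real.sign_of_neg (mul_neg_of_neg_of_pos hc hd)]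
    norm_num [hc.le]
  · simp [Real.sign_of_pos hd]
  · simp [Real.sign_of_pos hd, Real.sign_of_pos (mul_pos hc hd), hc]

/-- For four distinct points `x, y, z, p` in the plane with `x, y, z` not
collinear, `p` lies in the interior of the triangle `conv {x, y, z}` if and only if
`∇xyz = ∇xyp = ∇xpz = ∇pyz`. -/
theorem statement0 (x y z p : ℝ × ℝ)
    (hxy : x ≠ y) (hxz : x ≠ z) (hxp : x ≠ p) (hyz : y ≠ z) (hyp : y ≠ p) (hzp : z ≠ p)
    (hncol : orientDet x y z ≠ 0) :
    p ∈ interior (convexHull ℝ ({x, y, z} : Set (ℝ × ℝ))) ↔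
      orient x y z = orient x y p ∧ orient x y z = orient x p z ∧
        orient x y z = orient p y z := by
  have hind := affineIndependent_of_orientDet_ne_zero hncol
  let b : AffineBasis (Fin 3) ℝ (ℝ × ℝ) :=
    ⟨![x, y, z], hind, hind.affineSpan_eq_top_iff_card_eq_finrank_add_one.mpr (by simp)⟩
  have hrange : ({x, y, z} : Set (ℝ × ℝ)) = Set.range b := by
    change _ = Set.range ![x, y, z]
    ext q
    simp [eq_comm]
    tauto
  have hsum := b.sum_coord_apply_eq_one p
  have hp := b.linear_combination_coord_eq_self p
  have hb₀ : b 0 = x := rfl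
  have hb₁ : b 1 = y := rfl
  have hb₂ : b 2 = z := rfl
  rw [hrange, b.interior_convexHull, Set.mem_ofPred_eq, Fin.forall_fin_succ,
    Fin.forall_fin_two]
  simp only [Fin.sum_univ_three, hb₀, hb₁, hb₂, Prod.ext_iff, Prod.fst_add, Prod.snd_add,
    Prod.smul_fst, Prod.smul_snd, smul_eq_mul] at hsum hp
  obtain ⟨hp₁, hp₂⟩ := hp
  change 0 < b.coord 0 p ∧ 0 < b.coord 1 p ∧ 0 < b.coord 2 p ↔ _
  generalize b.coord 0 p = u at *
  generalize b.coord 1 p = v at *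
  generalize b.coord 2 p = w at *
  obtain rfl : u = 1 - v - w := by linarith
  have hxyp : orientDet x y p = w * orientDet x y z := by
    simp only [orientDet, ← hp₁, ← hp₂]; ring
  have hxpz : orientDet x p z = v * orientDet x y z := by
    simp only [orientDet, ← hp₁, ← hp₂]; ring
  have hpyz : orientDet p y z = (1 - v - w) * orientDet x y z := by
    simp only [orientDet, ← hp₁, ← hp₂]; ring
  simp only [orient, hxyp, hxpz, hpyz, sign_eq_sign_mul_iff hncol]
  tauto

end
end

section
/- Let C ⊆ ℝ² be a finite set of points in general position (no three points collinear) and let c ∈ C. Then c ∉ Ex(C), i.e. c ∈ convexHull(C \ {c}), if and only if there exist three distinct points x, y, z ∈ C \ {c} such that c lies in the interior of the triangle conv{x, y, z}. -/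
open scoped Classical

noncomputable section

theorem AffineBasis.sum_smul_mem_interior_convexHull {ι E : Type*} [Fintype ι]
    [NormedAddCommGroup E] [NormedSpace ℝ E] (b : AffineBasis ι ℝ E) {w : ι → ℝ}
    (hpos : ∀ i, 0 < w i) (hsum : ∑ i, w i = 1) :
    ∑ i, w i • b i ∈ interior (convexHull ℝ (Set.range b)) := by
  rw [b.interior_convexHull]
  intro i
  rw [← Finset.univ.affineCombination_eq_linear_combination b w hsum,
    b.coord_apply_combination_of_mem (Finset.mem_univ i) hsum]
  exact hpos i

theorem orientDet_smul_add_smul {p q : ℝ × ℝ} {s t : ℝ} (h : s + t = 1) :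
    orientDet p q (s • p + t • q) = 0 := by
  obtain rfl : s = 1 - t := by linarith
  simp only [orientDet, Prod.fst_add, Prod.snd_add, Prod.smul_fst, Prod.smul_snd, smul_eq_mul]
  ring

/-- A point of a convex hull in the plane is either one of the points, or a positive combination
of two distinct points, or interior to a triangle spanned by three distinct points. -/
theorem mem_or_mem_segment_or_mem_interior_of_mem_convexHull {s : Set (ℝ × ℝ)} {c : ℝ × ℝ}
    (hc : c ∈ convexHull ℝ s) :
    c ∈ s ∨ (∃ x ∈ s, ∃ y ∈ s, x ≠ y ∧ c ∈ segment ℝ x y) ∨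
      ∃ x ∈ s, ∃ y ∈ s, ∃ z ∈ s, x ≠ y ∧ x ≠ z ∧ y ≠ z ∧
        c ∈ interior (convexHull ℝ ({x, y, z} : Set (ℝ × ℝ))) := by
  obtain ⟨ι, _, v, w, hv, hind, hpos, hsum, rfl⟩ := eq_pos_convex_span_of_mem_convexHull hc
  have hmem : ∀ i, v i ∈ s := fun i => hv (Set.mem_range_self i)
  have hcard : Fintype.card ι ≤ 3 := by
    simpa using hind.card_le_finrank_succ.trans
      (Nat.add_le_add_right (Submodule.finrank_le _) 1)
  obtain ⟨n, hn⟩ : ∃ n, Fintype.card ι = n := ⟨_, rfl⟩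
  have e := (Fintype.equivFinOfCardEq hn).symm
  rw [hn] at hcard
  rw [← e.sum_comp] at hsum
  have hne : ∀ {i j : Fin n}, i ≠ j → v (e i) ≠ v (e j) := fun h =>
    hind.injective.ne (e.injective.ne h)
  interval_cases n
  · simp at hsum
  · left
    rw [← e.sum_comp]
    simp only [Fin.sum_univ_one] at hsum ⊢
    simpa [hsum] using hmem (e 0)
  · right; left
    rw [← e.sum_comp]
    simp only [Fin.sum_univ_two] at hsum ⊢
    exact ⟨_, hmem (e 0), _, hmem (e 1), hne (by decide),
      _, _, (hpos _).le, (hpos _).le, hsum, rfl⟩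
  · right; right
    refine ⟨_, hmem (e 0), _, hmem (e 1), _, hmem (e 2), hne (by decide), hne (by decide),
      hne (by decide), ?_⟩
    have hspan : affineSpan ℝ (Set.range v) = ⊤ :=
      hind.affineSpan_eq_top_iff_card_eq_finrank_add_one.2 (by simp [hn])
    have hrange : ({v (e 0), v (e 1), v (e 2)} : Set (ℝ × ℝ)) = Set.range v := by
      rw [← e.surjective.range_comp v]
      ext p
      simp only [Set.mem_insert_iff, Set.mem_singleton_iff, Set.mem_range, Function.comp_apply,
        Fin.exists_fin_succ, Fin.exists_fin_zero, or_false, eq_comm (a := p)]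
      rfl
    rw [hrange]
    rw [e.sum_comp] at hsum
    exact AffineBasis.sum_smul_mem_interior_convexHull ⟨v, hind, hspan⟩ hpos hsum

/-- For a finite set `C` in general position and `c ∈ C`, the point `c` is
non-extremal (i.e. `c ∈ convexHull (C \ {c})`) iff there are three distinct points
`x, y, z ∈ C \ {c}` such that `c` lies in the interior of the triangle `conv {x, y, z}`. -/
theorem statement1 (C : Finset (ℝ × ℝ)) (hgp : GenPos (↑C : Set (ℝ × ℝ)))
    (c : ℝ × ℝ) (hc : c ∈ C) :
    c ∈ convexHull ℝ ((C.erase c : Finset (ℝ × ℝ)) : Set (ℝ × ℝ)) ↔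
      ∃ x ∈ C.erase c, ∃ y ∈ C.erase c, ∃ z ∈ C.erase c,
        x ≠ y ∧ x ≠ z ∧ y ≠ z ∧
          c ∈ interior (convexHull ℝ ({x, y, z} : Set (ℝ × ℝ))) := by
  constructor
  · intro h
    rcases mem_or_mem_segment_or_mem_interior_of_mem_convexHull h with
      h | ⟨x, hx, y, hy, hxy, s, t, -, -, hst, hcomb⟩ | h
    · simp at h
    · rw [Finset.mem_coe, Finset.mem_erase] at hx hy
      refine absurd ?_ (hgp x hx.2 y hy.2 c hc hxy hx.1 hy.1)
      rw [← hcomb]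
      exact orientDet_smul_add_smul hst
    · exact h
  · rintro ⟨x, hx, y, hy, z, hz, -, -, -, h⟩
    refine convexHull_mono ?_ (interior_subset h)
    rintro p (rfl | rfl | rfl) <;> assumption

end
end

section
/- Let 𝒞, 𝒟 ⊆ ℝ² be finite sets of points in general position (no three points collinear) and let π : 𝒞 → 𝒟 be a bijection for which there exists a sign σ ∈ {−1, +1} such that ∇π(p)π(q)π(r) = σ·∇pqr for all triples (p, q, r) of distinct points of 𝒞. Then for every subset C ⊆ 𝒞, writing D = π(C), one has Ex(D) = π(Ex(C)). -/
open scoped Classical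

noncomputable section

/-- If `c` is a positive combination of `p, q, r`, then the triangles `c p q`, `c q r`, `c r p`
have the same orientation. -/
theorem orient_eq_of_pos_combination {c p q r : ℝ × ℝ} {u v w : ℝ} (hu : 0 < u) (hv : 0 < v)
    (hw : 0 < w) (hsum : u + v + w = 1) (hc : u • p + v • q + w • r = c) :
    orient c p q = orient p q r ∧ orient c q r = orient p q r ∧ orient c r p = orient p q r := by
  obtain rfl : u = 1 - v - w := by linarith
  have sign_mul {t x : ℝ} (ht : 0 < t) : Real.sign (t * x) = Real.sign x := by
    rcases lt_trichotomy x 0 with hx | rfl | hx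
    · rw [Real.sign_of_neg hx, Real.sign_of_neg (mul_neg_of_pos_of_neg ht hx)]
    · rw [mul_zero]
    · rw [Real.sign_of_pos hx, Real.sign_of_pos (mul_pos ht hx)]
  have h₁ : orientDet c p q = w * orientDet p q r := by
    simp only [← hc, orientDet, Prod.fst_add, Prod.snd_add, Prod.smul_fst, Prod.smul_snd,
      smul_eq_mul]
    ring
  have h₂ : orientDet c q r = (1 - v - w) * orientDet p q r := by
    simp only [← hc, orientDet, Prod.fst_add, Prod.snd_add, Prod.smul_fst, Prod.smul_snd,
      smul_eq_mul]
    ring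
  have h₃ : orientDet c r p = v * orientDet p q r := by
    simp only [← hc, orientDet, Prod.fst_add, Prod.snd_add, Prod.smul_fst, Prod.smul_snd,
      smul_eq_mul]
    ring
  simp only [orient, h₁, h₂, h₃, sign_mul hu, sign_mul hv, sign_mul hw, and_self]

theorem real_sign_eq_one_iff {x : ℝ} : Real.sign x = 1 ↔ 0 < x := by
  rcases lt_trichotomy x 0 with hx | rfl | hx
  · rw [Real.sign_of_neg hx]
    exact iff_of_false (by norm_num) hx.not_gt
  · simp
  · exact iff_of_true (Real.sign_of_pos hx) hx

theorem real_sign_eq_neg_one_iff {x : ℝ} : Real.sign x = -1 ↔ x < 0 := by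
  rw [← neg_pos, ← real_sign_eq_one_iff, Real.sign_neg, neg_eq_iff_eq_neg]

/-- If the triangles `c p q`, `c q r`, `c r p` are nondegenerate and have the same orientation,
then `c` lies in the convex hull of any set containing `p, q, r`. -/
theorem mem_convexHull_of_orient_eq {S : Set (ℝ × ℝ)} {c p q r : ℝ × ℝ} (hp : p ∈ S) (hq : q ∈ S)
    (hr : r ∈ S) (h₀ : orientDet c p q ≠ 0) (h₁ : orient c p q = orient c q r)
    (h₂ : orient c p q = orient c r p) : c ∈ convexHull ℝ S := by
  have combination {x y z : ℝ} (hx : 0 ≤ x) (hy : 0 ≤ y) (hz : 0 ≤ z) (hpos : 0 < x + y + z)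
      (hc : x • (p - c) + y • (q - c) + z • (r - c) = 0) : c ∈ convexHull ℝ S := by
    have hconv := convex_convexHull ℝ S
    have hcomb : (x / (x + y + z)) • p + (y / (x + y + z)) • q + (z / (x + y + z)) • r = c := by
      rw [Prod.ext_iff] at hc ⊢
      simp only [Prod.fst_add, Prod.snd_add, Prod.smul_fst, Prod.smul_snd, Prod.fst_sub,
        Prod.snd_sub, smul_eq_mul, Prod.fst_zero, Prod.snd_zero] at hc ⊢
      constructor <;> field_simp <;> linarith [hc.1, hc.2]
    rw [← hcomb]
    have hmem := hconv.sum_mem (t := Finset.univ)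
      (w := ![x / (x + y + z), y / (x + y + z), z / (x + y + z)]) (z := ![p, q, r])
      (by simp only [Finset.mem_univ, forall_const, Fin.forall_fin_succ]
          refine ⟨?_, ?_, ?_, ?_⟩ <;> simp <;> positivity)
      (by simp only [Fin.sum_univ_three, Matrix.cons_val]; field_simp)
      (by simp only [Finset.mem_univ, forall_const, Fin.forall_fin_succ]
          simp [subset_convexHull ℝ S hp, subset_convexHull ℝ S hq, subset_convexHull ℝ S hr])
    simpa only [Fin.sum_univ_three, Matrix.cons_val] using hmem
  have hdet : orientDet c q r • (p - c) + orientDet c r p • (q - c) + orientDet c p q • (r - c)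
      = 0 := by
    ext <;> simp [orientDet] <;> ring
  simp only [orient] at h₁ h₂
  rcases h₀.lt_or_gt with h | h
  · rw [Real.sign_of_neg h, eq_comm, real_sign_eq_neg_one_iff] at h₁ h₂
    refine combination (x := -orientDet c q r) (y := -orientDet c r p) (z := -orientDet c p q)
      (by linarith) (by linarith) (by linarith) (by linarith) ?_
    rw [neg_smul, neg_smul, neg_smul, ← neg_add, ← neg_add, hdet, neg_zero]
  · rw [Real.sign_of_pos h, eq_comm, real_sign_eq_one_iff] at h₁ h₂
    exact combination h₁.le h₂.le h.le (by linarith) hdet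

/-- In general position, a point `c` outside `S` lies in the convex hull of `S` if and only if it
lies inside a triangle spanned by `S`, which can be read off from orientations. -/
theorem mem_convexHull_iff_exists_orient_eq {S : Set (ℝ × ℝ)} {c : ℝ × ℝ} (hcS : c ∉ S)
    (hgp : GenPos (insert c S)) :
    c ∈ convexHull ℝ S ↔ ∃ p ∈ S, ∃ q ∈ S, ∃ r ∈ S, p ≠ q ∧ p ≠ r ∧ q ≠ r ∧
      orient c p q = orient c q r ∧ orient c p q = orient c r p := by
  constructor
  · intro h
    obtain ⟨ι, _, z, w, hz, hind, hw, hsum, hcomb⟩ := eq_pos_convex_span_of_mem_convexHull h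
    have hcard : Fintype.card ι ≤ 3 := by
      refine hind.card_le_finrank_succ.trans (Nat.succ_le_succ ?_)
      refine (Submodule.finrank_le _).trans ?_
      simp
    obtain ⟨n, ⟨e⟩⟩ := Finite.exists_equiv_fin ι
    have hn : n ≤ 3 := by simpa [Fintype.card_congr e] using hcard
    have hz' (i : Fin n) : z (e.symm i) ∈ S := hz ⟨_, rfl⟩
    have hne {i j : Fin n} (hij : i ≠ j) : z (e.symm i) ≠ z (e.symm j) := fun heq =>
      hij (e.symm.injective (hind.injective heq))
    rw [← e.symm.sum_comp] at hsum hcomb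
    interval_cases n
    · simp at hsum
    · simp only [Fin.sum_univ_one] at hsum hcomb
      rw [hsum, one_smul] at hcomb
      exact absurd (hcomb ▸ hz' 0) hcS
    · simp only [Fin.sum_univ_two] at hsum hcomb
      have hc (i) : c ≠ z (e.symm i) := fun heq => hcS (heq ▸ hz' i)
      refine absurd ?_ (hgp c (Set.mem_insert _ _) _ (Set.mem_insert_of_mem _ (hz' 0)) _
        (Set.mem_insert_of_mem _ (hz' 1)) (hc 0) (hc 1) (hne (by decide)))
      rw [← eq_sub_iff_add_eq] at hsum
      simp only [← hcomb, hsum, orientDet, Prod.fst_add, Prod.snd_add, Prod.smul_fst,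
        Prod.smul_snd, smul_eq_mul]
      ring
    · simp only [Fin.sum_univ_three] at hsum hcomb
      obtain ⟨h₁, h₂, h₃⟩ := orient_eq_of_pos_combination (hw _) (hw _) (hw _) hsum hcomb
      exact ⟨_, hz' 0, _, hz' 1, _, hz' 2, hne (by decide), hne (by decide), hne (by decide),
        h₁.trans h₂.symm, h₁.trans h₃.symm⟩
  · rintro ⟨p, hp, q, hq, r, hr, hpq, -, -, h₁, h₂⟩
    exact mem_convexHull_of_orient_eq hp hq hr
      (hgp c (Set.mem_insert _ _) p (Set.mem_insert_of_mem _ hp) q (Set.mem_insert_of_mem _ hq)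
        (fun h => hcS (h ▸ hp)) (fun h => hcS (h ▸ hq)) hpq) h₁ h₂

theorem GenPos.mono {S T : Set (ℝ × ℝ)} (hT : GenPos T) (hST : S ⊆ T) : GenPos S :=
  fun p hp q hq r hr => hT p (hST hp) q (hST hq) r (hST hr)

/-- An injective map that multiplies all orientations by a nonzero factor preserves and reflects
membership of a point in the convex hull of a set. -/
theorem map_mem_convexHull_image_iff {S : Set (ℝ × ℝ)} {c : ℝ × ℝ} {f : ℝ × ℝ → ℝ × ℝ} {σ : ℝ}
    (hcS : c ∉ S) (hgp : GenPos (insert c S)) (hgpf : GenPos (f '' insert c S))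
    (hf : Set.InjOn f (insert c S)) (hσ : σ ≠ 0)
    (hpres : ∀ p ∈ S, ∀ q ∈ S, p ≠ q → orient (f c) (f p) (f q) = σ * orient c p q) :
    f c ∈ convexHull ℝ (f '' S) ↔ c ∈ convexHull ℝ S := by
  have hfcS : f c ∉ f '' S := by
    rintro ⟨p, hp, hpc⟩
    exact hcS (hf (Set.mem_insert_of_mem _ hp) (Set.mem_insert _ _) hpc ▸ hp)
  have hne {p q} (hp : p ∈ S) (hq : q ∈ S) : f p ≠ f q ↔ p ≠ q :=
    (hf.eq_iff (Set.mem_insert_of_mem _ hp) (Set.mem_insert_of_mem _ hq)).not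
  rw [Set.image_insert_eq] at hgpf
  rw [mem_convexHull_iff_exists_orient_eq hfcS hgpf, mem_convexHull_iff_exists_orient_eq hcS hgp]
  simp only [Set.exists_mem_image]
  refine exists_congr fun p => and_congr_right fun hp => exists_congr fun q =>
    and_congr_right fun hq => exists_congr fun r => and_congr_right fun hr => ?_
  rw [hne hp hq, hne hp hr, hne hq hr]
  refine and_congr_right fun hpq => and_congr_right fun hpr => and_congr_right fun hqr => ?_
  rw [hpres p hp q hq hpq, hpres q hq r hr hqr, hpres r hr p hp hpr.symm,
    mul_right_inj' hσ, mul_right_inj' hσ]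

/-- If `π` is a bijection between two finite sets `𝒞, 𝒟` in general position
that multiplies all orientations by a fixed sign `σ ∈ {−1, +1}`, then for every `C ⊆ 𝒞`,
setting `D = π(C)`, we have `Ex(D) = π(Ex(C))`. -/
theorem statement2 (𝒞 𝒟 : Finset (ℝ × ℝ))
    (hgp𝒞 : GenPos (↑𝒞 : Set (ℝ × ℝ))) (hgp𝒟 : GenPos (↑𝒟 : Set (ℝ × ℝ)))
    (π : ℝ × ℝ → ℝ × ℝ) (hbij : Set.BijOn π (↑𝒞 : Set (ℝ × ℝ)) (↑𝒟 : Set (ℝ × ℝ)))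
    (σ : ℝ) (hσ : σ = 1 ∨ σ = -1)
    (hpres : ∀ p ∈ 𝒞, ∀ q ∈ 𝒞, ∀ r ∈ 𝒞, p ≠ q → p ≠ r → q ≠ r →
      orient (π p) (π q) (π r) = σ * orient p q r)
    (C : Finset (ℝ × ℝ)) (hC : C ⊆ 𝒞) :
    exPts (C.image π) = (exPts C).image π := by
  have hσ₀ : σ ≠ 0 := by rcases hσ with rfl | rfl <;> norm_num
  have hinj : Set.InjOn π ↑C := hbij.injOn.mono (Finset.coe_subset.2 hC)
  rw [exPts, exPts, Finset.filter_image]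
  refine congrArg _ (Finset.filter_congr fun c hc => not_congr ?_)
  have hcS : c ∉ ((C.erase c : Finset (ℝ × ℝ)) : Set (ℝ × ℝ)) := by simp
  have hins : insert c ((C.erase c : Finset (ℝ × ℝ)) : Set (ℝ × ℝ)) = ↑C := by
    rw [← Finset.coe_insert, Finset.insert_erase hc]
  have herase : (((C.image π).erase (π c) : Finset (ℝ × ℝ)) : Set (ℝ × ℝ))
      = π '' ((C.erase c : Finset (ℝ × ℝ)) : Set (ℝ × ℝ)) := by
    rw [Finset.coe_erase, Finset.coe_image, Finset.coe_erase, hinj.image_sdiff_subset (by simpa),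
      Set.image_singleton]
  rw [herase]
  refine map_mem_convexHull_image_iff hcS ?_ ?_ ?_ hσ₀ ?_
  · exact hins ▸ hgp𝒞.mono (Finset.coe_subset.2 hC)
  · rw [hins]
    exact hgp𝒟.mono ((Set.image_mono (Finset.coe_subset.2 hC)).trans hbij.image_eq.subset)
  · exact hins ▸ hinj
  · intro p hp q hq hpq
    rw [Finset.mem_coe, Finset.mem_erase] at hp hq
    exact hpres c (hC hc) p (hC hp.2) q (hC hq.2) hp.1.symm hq.1.symm hpq

end
end

section
/- For every odd integer k > 2 there exists a cake 𝒮 consisting of 4k + 1 points, of which exactly 2k are red and 2k + 1 are green (so 𝒮 is odd-sized), such that M(𝒮) ≥ (3k − 1)/2 = (3/4)·R(𝒮) − 1/2. -/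
open scoped Classical

noncomputable section

theorem exPts_nonempty {C : Finset (ℝ × ℝ)} (hC : C.Nonempty) : (exPts C).Nonempty := by
  have hcomp : IsCompact (convexHull ℝ (C : Set (ℝ × ℝ))) := C.finite_toSet.isCompact_convexHull ℝ
  obtain ⟨p, hp⟩ := hcomp.extremePoints_nonempty ((convexHull_nonempty_iff).2 hC)
  have hpC : p ∈ (C : Set (ℝ × ℝ)) := extremePoints_convexHull_subset hp
  refine ⟨p, Finset.mem_filter.2 ⟨hpC, fun hmem => ?_⟩⟩
  have := ((convex_convexHull ℝ (C : Set (ℝ × ℝ))).mem_extremePoints_iff_mem_sdiff_convexHull_sdiff.1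
    hp).2
  refine this (convexHull_mono (fun q hq => ?_) hmem)
  rw [Finset.mem_coe, Finset.mem_erase] at hq
  exact ⟨subset_convexHull ℝ _ hq.2, hq.1⟩

theorem le_gameM {w : ℝ × ℝ → ℕ} {C : Finset (ℝ × ℝ)} {v : ℕ} (hC : 2 ≤ C.card)
    (h : ∀ a ∈ exPts C, ∃ b ∈ exPts (C.erase a), v ≤ w b + gameM w ((C.erase a).erase b)) :
    v ≤ gameM w C := by
  rw [gameM, dif_neg (by omega)]
  apply le_csInf
  · obtain ⟨a, ha⟩ := exPts_nonempty (Finset.card_pos.1 (by omega : 0 < C.card))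
    exact ⟨_, Finset.mem_coe.2 (Finset.mem_image_of_mem _ (Finset.mem_attach _ ⟨a, ha⟩))⟩
  · intro x hx
    obtain ⟨a, -, rfl⟩ := Finset.mem_image.1 (Finset.mem_coe.1 hx)
    obtain ⟨b, hb, hv⟩ := h a.1 a.2
    exact hv.trans (Finset.le_sup (f := fun b : {b // b ∈ exPts (C.erase a.1)} =>
      w b.1 + gameM w ((C.erase a.1).erase b.1)) (Finset.mem_attach _ ⟨b, hb⟩))

/-- The point with index `a` is extremal among the points with indices in `I`. -/
def Exposed {ι : Type} [DecidableEq ι] (P : ι → ℝ × ℝ) (I : Finset ι) (a : ι) : Prop :=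
  P a ∉ convexHull ℝ (P '' (I.erase a : Finset ι))

theorem le_gameM_image {ι : Type} [DecidableEq ι] {P : ι → ℝ × ℝ} (hP : Function.Injective P)
    {w : ℝ × ℝ → ℕ} {I : Finset ι} {v : ℕ} (hI : 2 ≤ I.card)
    (h : ∀ a ∈ I, Exposed P I a → ∃ b ∈ I.erase a, Exposed P (I.erase a) b ∧
      v ≤ w (P b) + gameM w (((I.erase a).erase b).image P)) :
    v ≤ gameM w (I.image P) := by
  have key : ∀ (J : Finset ι) (a : ι), P a ∈ exPts (J.image P) ↔ a ∈ J ∧ Exposed P J a := by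
    intro J a
    rw [exPts, Finset.mem_filter, hP.mem_finset_image, Exposed, ← Finset.image_erase hP,
      Finset.coe_image]
  refine le_gameM (by rwa [Finset.card_image_of_injective _ hP]) fun p hp => ?_
  obtain ⟨a, -, rfl⟩ := Finset.mem_image.1 (Finset.mem_filter.1 hp).1
  obtain ⟨haI, ha⟩ := (key I a).1 hp
  obtain ⟨b, hbI, hb, hv⟩ := h a haI ha
  refine ⟨P b, ?_, ?_⟩
  · rw [← Finset.image_erase hP]
    exact (key _ b).2 ⟨hbI, hb⟩
  · rwa [← Finset.image_erase hP, ← Finset.image_erase hP]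

/-- `CCW i j` says that the `j`-th ray lies less than a half turn counterclockwise from the
`i`-th ray. -/
def CCW {k : ℕ} (i j : Fin k) : Prop :=
  (i.1 < j.1 ∧ (i.1 + j.1) % 2 = 0) ∨ (j.1 < i.1 ∧ (i.1 + j.1) % 2 = 1)

theorem CCW.total {k : ℕ} {i j : Fin k} (h : i ≠ j) : CCW i j ∨ CCW j i := by
  have : i.1 ≠ j.1 := fun e => h (Fin.ext e)
  unfold CCW
  omega

theorem CCW.asymm {k : ℕ} {i j : Fin k} (h : CCW i j) : ¬ CCW j i := by
  unfold CCW at *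
  omega

theorem CCW.ne {k : ℕ} {i j : Fin k} (h : CCW i j) : i ≠ j := by
  rintro rfl
  exact h.asymm h

theorem card_le_of_forall_CCW {k : ℕ} (hk : Odd k) {J : Finset (Fin k)} {j₀ : Fin k}
    (hJ : ∀ j ∈ J, j ≠ j₀ → CCW j j₀) : J.card ≤ (k + 1) / 2 := by
  obtain ⟨m, rfl⟩ := hk
  have hlt : ∀ j ∈ J, (j.1 < j₀.1 ∧ (j.1 + j₀.1) % 2 = 0) ∨
      (j₀.1 < j.1 ∧ (j.1 + j₀.1) % 2 = 1) ∨ j.1 = j₀.1 := by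
    intro j hj
    by_cases h : j = j₀
    · simp [h]
    · have := hJ j hj h
      unfold CCW at this
      omega
  have := Finset.card_le_card_of_injOn (s := J) (t := Finset.range (m + 1))
    (fun j => (j.1 + (j₀.1 + 1) % 2) / 2) (fun j hj => by
      have := hlt j hj
      have := j.2
      simp only [Finset.coe_range, Set.mem_Iio]
      omega) (fun i hi j hj e => by
      have hi := hlt i hi
      have hj := hlt j hj
      simp only at e
      apply Fin.ext
      omega)
  rw [Finset.card_range] at this
  omega

/-- The indices of the points: `none` is the centre and `some (j, i)` is the `i`-th point, counted
from the outside, of the `j`-th chain. -/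
abbrev Idx (k : ℕ) : Type := Option (Fin k × Fin 4)

/-- The chain `j` meets `I`. -/
def Occ {k : ℕ} (I : Finset (Idx k)) (j : Fin k) : Prop := ∃ i, some (j, i) ∈ I

theorem Occ.mono {k : ℕ} {I I' : Finset (Idx k)} (h : I ⊆ I') {j : Fin k} (hj : Occ I j) :
    Occ I' j :=
  hj.imp fun _ hi => h hi

theorem Occ.erase {k : ℕ} {I : Finset (Idx k)} {j j' : Fin k} {i : Fin 4} (h : Occ I j')
    (hne : j' ≠ j) : Occ (I.erase (some (j, i))) j' :=
  h.imp fun _ hi => Finset.mem_erase.2 ⟨by simp [hne], hi⟩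

/-- Points forming `k` short, almost radial chains around a centre, the combinatorial description
of which points are extremal being recorded in the fields. -/
structure ChainCake (k : ℕ) where
  /-- The points. -/
  P : Idx k → ℝ × ℝ
  inj : Function.Injective P
  genPos : ∀ x y z, x ≠ y → x ≠ z → y ≠ z → orientDet (P x) (P y) (P z) ≠ 0
  exposed_top : ∀ (I : Finset (Idx k)) j i, (∀ i' < i, some (j, i') ∉ I) →
    Exposed P I (some (j, i))
  exposed_left : ∀ (I : Finset (Idx k)) j i, (∀ j', Occ I j' → j' ≠ j → CCW j' j) →
    Exposed P I (some (j, i))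
  exposed_right : ∀ (I : Finset (Idx k)) j, none ∉ I → (∀ j', Occ I j' → j' ≠ j → CCW j j') →
    Exposed P I (some (j, 3))
  hidden : ∀ (I : Finset (Idx k)) j i i' j', i < i' → some (j, i) ∈ I → Occ I j' → CCW j j' →
    (none ∈ I ∨ ∃ j'', Occ I j'' ∧ CCW j'' j) → ¬ Exposed P I (some (j, i'))
  hidden_center : ∀ (I : Finset (Idx k)), (∃ j, Occ I j) →
    (∀ j, Occ I j → ∃ j', Occ I j' ∧ CCW j j') → ¬ Exposed P I none

/-- Every second point of each chain is red; the outermost points and the centre are green. -/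
def IsRed {k : ℕ} : Idx k → Prop
  | none => False
  | some (_, i) => i = 1 ∨ i = 3

namespace ChainCake

variable {k : ℕ} (A : ChainCake k)

/-- The weight function of the cake. -/
def w (p : ℝ × ℝ) : ℕ := if ∃ a, IsRed a ∧ A.P a = p then 1 else 0

theorem w_le_one (p : ℝ × ℝ) : A.w p ≤ 1 := by
  unfold w
  split_ifs <;> simp

theorem w_P (a : Idx k) : A.w (A.P a) = if IsRed a then 1 else 0 := by
  unfold w
  congr 1
  exact propext ⟨fun ⟨b, hb, e⟩ => A.inj e ▸ hb, fun h => ⟨a, h, rfl⟩⟩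

/-- The minimax result of the subcake with indices in `I`, with Alice to move. -/
def val (I : Finset (Idx k)) : ℕ := gameM A.w (I.image A.P)

theorem le_val {I : Finset (Idx k)} {v : ℕ} (hI : 2 ≤ I.card)
    (h : ∀ a ∈ I, Exposed A.P I a → ∃ b ∈ I.erase a, Exposed A.P (I.erase a) b ∧
      v ≤ (if IsRed b then 1 else 0) + A.val ((I.erase a).erase b)) : v ≤ A.val I := by
  refine le_gameM_image A.inj hI fun a ha hexp => ?_
  obtain ⟨b, hb, hb', hv⟩ := h a ha hexp
  exact ⟨b, hb, hb', by rwa [A.w_P]⟩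

/-- The chains in `F` still have both red points, and, unless such a chain is the last one
counterclockwise, only its outermost point, which is green, is extremal. -/
structure Guarded (ρ : Fin k → ℕ) (I : Finset (Idx k)) (F : Finset (Fin k)) : Prop where
  rank : ∀ j j', Occ I j → Occ I j' → CCW j j' → ρ j < ρ j'
  one : ∀ j ∈ F, some (j, 1) ∈ I
  three : ∀ j ∈ F, some (j, 3) ∈ I
  top : ∀ j ∈ F, ∀ j', Occ I j' → CCW j j' → some (j, 0) ∈ I
  right : ∀ j ∈ F, ∀ j', Occ I j' → CCW j j' → none ∈ I ∨ ∃ j'', Occ I j'' ∧ CCW j'' j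

/-- As long as the remaining chains lie in a half plane, Bob gets a red point out of each chain that
is still guarded. -/
theorem card_le_val_of_guarded (ρ : Fin k → ℕ) (I : Finset (Idx k)) (F : Finset (Fin k))
    (h : Guarded ρ I F) : F.card ≤ A.val I := by
  induction hn : I.card using Nat.strong_induction_on generalizing I F with
  | _ n ih =>
  subst hn
  rcases F.eq_empty_or_nonempty with rfl | ⟨jF, hjF⟩
  · simp
  have hcard : 2 ≤ I.card := by
    have : ({some (jF, 1), some (jF, 3)} : Finset (Idx k)) ⊆ I := by
      intro x hx
      simp only [Finset.mem_insert, Finset.mem_singleton] at hx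
      rcases hx with rfl | rfl
      exacts [h.one _ hjF, h.three _ hjF]
    exact le_trans (by rw [Finset.card_pair]; simp) (Finset.card_le_card this)
  have IH : ∀ a ∈ I, ∀ b ∈ I.erase a, ∀ F', Guarded ρ ((I.erase a).erase b) F' →
      F'.card ≤ A.val ((I.erase a).erase b) := fun a ha b hb F' hF' =>
    ih _ ((Finset.card_erase_lt_of_mem hb).trans_le Finset.card_erase_le) _ _ hF' rfl
  have red : ∀ a ∈ I, ∀ j ∈ F, ∀ b ∈ I.erase a, IsRed b →
      Guarded ρ ((I.erase a).erase b) (F.erase j) →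
      F.card ≤ (if IsRed b then 1 else 0) + A.val ((I.erase a).erase b) := by
    intro a ha j hj b hb hred hG
    have := IH a ha b hb _ hG
    rw [Finset.card_erase_of_mem hj] at this
    rw [if_pos hred]
    omega
  have hblock : ∀ j ∈ F, ∀ i, i ≠ 0 → Exposed A.P I (some (j, i)) →
      ∀ j', Occ I j' → ¬ CCW j j' := by
    intro j hj i hi hexp j' hj' hjj'
    exact A.hidden I j 0 i j' (Fin.pos_of_ne_zero hi) (h.top j hj j' hj' hjj') hj' hjj'
      (h.right j hj j' hj' hjj') hexp
  refine A.le_val hcard fun a ha hexp => ?_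
  have hsub : ∀ b, (I.erase a).erase b ⊆ I := fun b =>
    (Finset.erase_subset _ _).trans (Finset.erase_subset _ _)
  by_cases haF : ∃ j ∈ F, ∃ i, a = some (j, i)
  · obtain ⟨j, hj, i, rfl⟩ := haF
    -- Bob answers in the chain `j`, which stays occupied or is the last one.
    have reply : ∀ b : Fin 4, b = 1 ∨ b = 3 → b ≠ i →
        (i = 0 → b = 1) →
        (Occ ((I.erase (some (j, i))).erase (some (j, b))) j ∨ ∀ j', Occ I j' → ¬ CCW j j') →
        ∃ b ∈ I.erase (some (j, i)), Exposed A.P (I.erase (some (j, i))) b ∧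
          F.card ≤ (if IsRed b then 1 else 0) + A.val ((I.erase (some (j, i))).erase b) := by
      intro b hb hbi hb0 hocc
      have hbI : some (j, b) ∈ I.erase (some (j, i)) := by
        refine Finset.mem_erase.2 ⟨by simpa using hbi, ?_⟩
        rcases hb with rfl | rfl
        exacts [h.one _ hj, h.three _ hj]
      refine ⟨some (j, b), hbI, ?_, red _ ha j hj _ hbI hb ?_⟩
      · by_cases hi : i = 0
        · rw [hb0 hi]
          refine A.exposed_top _ _ _ fun i' hi' => ?_
          have : i' = 0 := by omega
          simp [this, hi]
        · refine A.exposed_left _ _ _ fun j' hj' hne => ?_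
          exact (CCW.total hne).resolve_right
            (hblock j hj i hi hexp j' (hj'.mono (Finset.erase_subset _ _)))
      · have keep : ∀ j' ∈ F.erase j, ∀ i', some (j', i') ∈ I →
            some (j', i') ∈ (I.erase (some (j, i))).erase (some (j, b)) := by
          intro j' hj' i' hi'
          have := (Finset.mem_erase.1 hj').1
          simp [this, hi']
        refine ⟨fun _ _ h₁ h₂ => h.rank _ _ (h₁.mono (hsub _)) (h₂.mono (hsub _)),
          fun j' hj' => keep j' hj' _ (h.one _ (Finset.mem_of_mem_erase hj')),
          fun j' hj' => keep j' hj' _ (h.three _ (Finset.mem_of_mem_erase hj')),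
          fun j' hj' l hl hjl => keep j' hj' _
            (h.top _ (Finset.mem_of_mem_erase hj') l (hl.mono (hsub _)) hjl), ?_⟩
        intro j' hj' l hl hjl
        rcases h.right _ (Finset.mem_of_mem_erase hj') l (hl.mono (hsub _)) hjl with h0 | ⟨m, hm, hmj⟩
        · left
          simp [h0]
        · right
          refine ⟨m, ?_, hmj⟩
          by_cases hmj' : m = j
          · subst hmj'
            rcases hocc with hocc | hocc
            · exact hocc
            · exact absurd hmj (hocc j' ⟨_, h.one _ (Finset.mem_of_mem_erase hj')⟩)
          · exact (hm.erase hmj').erase hmj'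
    have h1 := h.one j hj
    have h3 := h.three j hj
    by_cases hi1 : i = 1
    · subst hi1
      exact reply 3 (Or.inr rfl) (by decide) (by decide) (Or.inr (hblock j hj 1 (by decide) hexp))
    by_cases hi3 : i = 3
    · subst hi3
      exact reply 1 (Or.inl rfl) (by decide) (by decide) (Or.inr (hblock j hj 3 (by decide) hexp))
    refine reply 1 (Or.inl rfl) (Ne.symm hi1) (fun _ => rfl) (Or.inl ⟨3, ?_⟩)
    simp [h3, Ne.symm hi3]
  -- Alice has not touched a guarded chain.
  push Not at haF
  have keep : ∀ j ∈ F, ∀ i, some (j, i) ∈ I → some (j, i) ∈ I.erase a := fun j hj i hi =>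
    Finset.mem_erase.2 ⟨fun e => haF j hj i e.symm, hi⟩
  have hsub' : I.erase a ⊆ I := Finset.erase_subset _ _
  -- removing a point of the chain `j` without emptying it
  have take : ∀ j ∈ F, ∀ b : Fin 4, b = 1 ∨ b = 3 → Exposed A.P (I.erase a) (some (j, b)) →
      (∀ j' ∈ F, j' ≠ j → ∀ l, Occ (I.erase a) l → CCW j' l →
        none ∈ I.erase a ∨ ∃ j'', Occ (I.erase a) j'' ∧ CCW j'' j') →
      ∃ b ∈ I.erase a, Exposed A.P (I.erase a) b ∧
        F.card ≤ (if IsRed b then 1 else 0) + A.val ((I.erase a).erase b) := by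
    intro j hj b hb hbexp hright
    have hbI : some (j, b) ∈ I.erase a := by
      rcases hb with rfl | rfl
      exacts [keep _ hj _ (h.one _ hj), keep _ hj _ (h.three _ hj)]
    refine ⟨some (j, b), hbI, hbexp, red _ ha j hj _ hbI hb ?_⟩
    have keep' : ∀ j' ∈ F.erase j, ∀ i', some (j', i') ∈ I →
        some (j', i') ∈ (I.erase a).erase (some (j, b)) := by
      intro j' hj' i' hi'
      obtain ⟨hne, hj'⟩ := Finset.mem_erase.1 hj'
      exact Finset.mem_erase.2 ⟨by simp [hne], keep _ hj' _ hi'⟩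
    refine ⟨fun _ _ h₁ h₂ => h.rank _ _ (h₁.mono (hsub _)) (h₂.mono (hsub _)),
      fun j' hj' => keep' j' hj' _ (h.one _ (Finset.mem_of_mem_erase hj')),
      fun j' hj' => keep' j' hj' _ (h.three _ (Finset.mem_of_mem_erase hj')),
      fun j' hj' l hl hjl => keep' j' hj' _
        (h.top _ (Finset.mem_of_mem_erase hj') l (hl.mono (hsub _)) hjl), ?_⟩
    intro j' hj' l hl hjl
    obtain ⟨hne, hj'⟩ := Finset.mem_erase.1 hj'
    rcases hright j' hj' hne l (hl.mono (Finset.erase_subset _ _)) hjl with h0 | ⟨m, hm, hmj⟩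
    · left
      simpa using h0
    · right
      refine ⟨m, ?_, hmj⟩
      by_cases hmj' : m = j
      · subst hmj'
        rcases hb with rfl | rfl
        · exact ⟨3, Finset.mem_erase.2 ⟨by simp, keep _ hj _ (h.three _ hj)⟩⟩
        · exact ⟨1, Finset.mem_erase.2 ⟨by simp, keep _ hj _ (h.one _ hj)⟩⟩
      · exact hm.erase hmj'
  by_cases hviol : ∃ j ∈ F, none ∉ I.erase a ∧ ∀ j', Occ (I.erase a) j' → ¬ CCW j' j
  · obtain ⟨j, hj, hnone, hj'⟩ := hviol
    refine take j hj 3 (Or.inr rfl) (A.exposed_right _ _ hnone fun j' hocc hne =>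
      (CCW.total hne).resolve_left (hj' j' hocc)) ?_
    intro j' hjF' hne l hl hjl
    right
    have hocc : ∀ m ∈ F, Occ (I.erase a) m := fun m hm => ⟨_, keep m hm _ (h.one m hm)⟩
    exact ⟨j, hocc j hj, (CCW.total hne).resolve_left (hj' j' (hocc j' hjF'))⟩
  · push Not at hviol
    have hright : ∀ j ∈ F, none ∈ I.erase a ∨ ∃ j'', Occ (I.erase a) j'' ∧ CCW j'' j := by
      intro j hj
      by_cases h0 : none ∈ I.erase a
      · exact Or.inl h0
      · exact Or.inr (hviol j hj h0)
    obtain ⟨j, hj, hmax⟩ := Finset.exists_max_image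
      (Finset.univ.filter fun j => Occ (I.erase a) j) ρ
      ⟨jF, by simpa using ⟨_, keep jF hjF _ (h.one jF hjF)⟩⟩
    simp only [Finset.mem_filter, Finset.mem_univ, true_and] at hj hmax
    have hlast : ∀ j', Occ (I.erase a) j' → ¬ CCW j j' := fun j' hj' hc =>
      absurd (h.rank _ _ (hj.mono hsub') (hj'.mono hsub') hc) (not_lt.2 (hmax j' hj'))
    have hexp' : ∀ b, Exposed A.P (I.erase a) (some (j, b)) := fun b =>
      A.exposed_left _ _ _ fun j' hj' hne => (CCW.total hne).resolve_right (hlast j' hj')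
    by_cases hjF' : j ∈ F
    · exact take j hjF' 1 (Or.inl rfl) (hexp' 1) fun j' hj' _ _ _ _ => hright j' hj'
    · obtain ⟨b, hb⟩ := hj
      refine ⟨some (j, b), hb, hexp' b, ?_⟩
      have keep' : ∀ j' ∈ F, ∀ i', some (j', i') ∈ I →
          some (j', i') ∈ (I.erase a).erase (some (j, b)) := by
        intro j' hj' i' hi'
        have hne : j' ≠ j := fun e => hjF' (e ▸ hj')
        exact Finset.mem_erase.2 ⟨by simp [hne], keep _ hj' _ hi'⟩
      refine le_add_left (IH a ha _ hb F
        ⟨fun _ _ h₁ h₂ => h.rank _ _ (h₁.mono (hsub _)) (h₂.mono (hsub _)),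
        fun j' hj' => keep' j' hj' _ (h.one _ hj'), fun j' hj' => keep' j' hj' _ (h.three _ hj'),
        fun j' hj' l hl hjl => keep' j' hj' _ (h.top _ hj' l (hl.mono (hsub _)) hjl), ?_⟩)
      intro j' hj' _ _ _
      rcases hright j' hj' with h0 | ⟨m, hm, hmj⟩
      · left
        simpa using h0
      · refine Or.inr ⟨m, hm.erase ?_, hmj⟩
        rintro rfl
        exact hlast j' ⟨_, keep j' hj' _ (h.one j' hj')⟩ hmj

/-- Every chain is complete, reduced to its inner half, or exhausted, and the centre is present. -/
structure Paired (I : Finset (Idx k)) : Prop where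
  center : none ∈ I
  outer : ∀ j, some (j, 0) ∈ I ↔ some (j, 1) ∈ I
  inner : ∀ j, some (j, 2) ∈ I ↔ some (j, 3) ∈ I
  nested : ∀ j, some (j, 0) ∈ I → some (j, 2) ∈ I

theorem Paired.occ_iff {I : Finset (Idx k)} (h : Paired I) (j : Fin k) :
    Occ I j ↔ some (j, 3) ∈ I := by
  refine ⟨?_, fun hj => ⟨_, hj⟩⟩
  rintro ⟨i, hi⟩
  have h1 := h.outer j
  have h2 := h.inner j
  have h3 := h.nested j
  fin_cases i <;> simp at hi <;> tauto

theorem Paired.erase_outer {I : Finset (Idx k)} (h : Paired I) {j : Fin k} :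
    Paired ((I.erase (some (j, 0))).erase (some (j, 1))) := by
  refine ⟨by simpa using h.center, fun l => ?_, fun l => by simpa using h.inner l, fun l => ?_⟩
  · simpa using fun _ => h.outer l
  · simpa using fun _ => h.nested l

theorem Paired.erase_inner {I : Finset (Idx k)} (h : Paired I) {j : Fin k}
    (hj : some (j, 0) ∉ I) : Paired ((I.erase (some (j, 2))).erase (some (j, 3))) := by
  refine ⟨by simpa using h.center, fun l => by simpa using h.outer l, fun l => ?_, fun l => ?_⟩
  · simpa using fun _ => h.inner l
  · intro hl
    have hl0 : some (l, 0) ∈ I := by simpa using hl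
    have : l ≠ j := fun e => hj (e ▸ hl0)
    simpa [this] using h.nested l hl0

/-- The number of red points with indices in `I`. -/
def reds (I : Finset (Idx k)) : ℕ :=
  (Finset.univ.filter fun j => some (j, 1) ∈ I).card +
    (Finset.univ.filter fun j => some (j, 3) ∈ I).card

theorem reds_le_reds_erase_erase (I : Finset (Idx k)) (j : Fin k) (i i' : Fin 4) (h1 : i ≠ 1)
    (h3 : i ≠ 3) : reds I ≤ reds ((I.erase (some (j, i))).erase (some (j, i'))) + 1 := by
  have same : ∀ l, i ≠ l → i' ≠ l → (Finset.univ.filter fun m => some (m, l) ∈ I) =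
      Finset.univ.filter fun m => some (m, l) ∈ (I.erase (some (j, i))).erase (some (j, i')) := by
    intro l hl hl'
    ext m
    simp [hl.symm, hl'.symm]
  have lose : ∀ l, i ≠ l → (Finset.univ.filter fun m => some (m, l) ∈ I).card ≤
      (Finset.univ.filter fun m =>
        some (m, l) ∈ (I.erase (some (j, i))).erase (some (j, i'))).card + 1 := by
    intro l hl
    refine le_trans (Finset.card_le_card fun m hm => ?_) (Finset.card_insert_le j _)
    by_cases hmj : m = j <;> simp_all
  unfold reds
  by_cases hi' : i' = 1
  · have := lose 1 h1
    rw [same 3 h3 (by rw [hi']; decide)]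
    omega
  · have := lose 3 h3
    rw [same 1 h1 hi']
    omega

theorem reds_le_val_add (hk : Odd k) (I : Finset (Idx k)) (h : Paired I) :
    reds I ≤ A.val I + (k + 1) / 2 := by
  induction hn : I.card using Nat.strong_induction_on generalizing I with
  | _ n ih =>
  subst hn
  by_cases hlast : ∃ j₀, ∀ j, Occ I j → j ≠ j₀ → CCW j j₀
  · obtain ⟨j₀, hj₀⟩ := hlast
    have h3 : (Finset.univ.filter fun j => some (j, (3 : Fin 4)) ∈ I).card ≤ (k + 1) / 2 :=
      card_le_of_forall_CCW hk (j₀ := j₀) fun j hj => hj₀ j ⟨3, by simpa using hj⟩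
    refine add_le_add (A.card_le_val_of_guarded (fun j => if j ≤ j₀ then j.1 + k else j.1) I _ ?_) h3
    refine ⟨fun j j' hj hj' hc => ?_, fun j hj => by simpa using hj, fun j hj => ?_,
      fun j hj _ _ _ => ?_, fun j hj _ _ _ => Or.inl h.center⟩
    · have h1 : j.1 = j₀.1 ∨ CCW j j₀ := by
        by_cases e : j = j₀
        · exact Or.inl (congrArg _ e)
        · exact Or.inr (hj₀ j hj e)
      have h2 : j'.1 = j₀.1 ∨ CCW j' j₀ := by
        by_cases e : j' = j₀
        · exact Or.inl (congrArg _ e)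
        · exact Or.inr (hj₀ j' hj' e)
      have := j.2
      have := j'.2
      unfold CCW at *
      simp only [Fin.le_def]
      split_ifs <;> omega
    · have : some (j, 1) ∈ I := by simpa using hj
      exact (h.inner j).1 (h.nested j ((h.outer j).2 this))
    · exact (h.outer j).2 (by simpa using hj)
  push Not at hlast
  rcases Nat.eq_zero_or_pos k with rfl | hk0
  · simp [reds]
  have hleft : ∀ j, ∃ j', Occ I j' ∧ CCW j j' := by
    intro j
    obtain ⟨j', hj', hne, hc⟩ := hlast j
    exact ⟨j', hj', (CCW.total hne).resolve_left hc⟩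
  obtain ⟨j₁, hj₁, -⟩ := hleft ⟨0, hk0⟩
  have hcard : 2 ≤ I.card := by
    have : ({none, some (j₁, 3)} : Finset (Idx k)) ⊆ I := by
      intro x hx
      simp only [Finset.mem_insert, Finset.mem_singleton] at hx
      rcases hx with rfl | rfl
      exacts [h.center, (h.occ_iff _).1 hj₁]
    exact le_trans (by rw [Finset.card_pair]; simp) (Finset.card_le_card this)
  refine Nat.le_add_of_sub_le (A.le_val hcard fun a ha hexp => ?_)
  -- the answer to the move `i` in the chain `j`
  have reply : ∀ (j : Fin k) (i i' : Fin 4), a = some (j, i) → i' = 1 ∨ i' = 3 → i ≠ i' →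
      some (j, i') ∈ I → (∀ l < i', some (j, l) ∉ I.erase a) →
      Paired ((I.erase a).erase (some (j, i'))) →
      reds I ≤ reds ((I.erase a).erase (some (j, i'))) + 1 →
      ∃ b ∈ I.erase a, Exposed A.P (I.erase a) b ∧
        reds I - (k + 1) / 2 ≤ (if IsRed b then 1 else 0) + A.val ((I.erase a).erase b) := by
    intro j i i' e hred hne hi' htop hP hreds
    have hb : some (j, i') ∈ I.erase a := Finset.mem_erase.2 ⟨by simp [e, hne.symm], hi'⟩
    refine ⟨_, hb, A.exposed_top _ _ _ htop, ?_⟩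
    have := ih _ ((Finset.card_erase_lt_of_mem hb).trans_le Finset.card_erase_le) _ hP rfl
    rw [if_pos (show IsRed (some (j, i')) from hred)]
    omega
  match a, ha, hexp, reply with
  | none, ha, hexp, _ => exact absurd hexp (A.hidden_center I ⟨j₁, hj₁⟩ fun j _ => hleft j)
  | some (j, i), ha, hexp, reply =>
    obtain ⟨j', hj', hjj'⟩ := hleft j
    have hid : ∀ i', i' < i → some (j, i') ∉ I := fun i' hlt hi' =>
      A.hidden I j i' i j' hlt hi' hj' hjj' (Or.inl h.center) hexp
    have h1 := h.outer
    have h2 := h.inner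
    have h3 := h.nested
    fin_cases i
    · refine reply j 0 1 rfl (Or.inl rfl) (by decide) ((h1 j).1 ha) (fun l hl => ?_) h.erase_outer
        (reds_le_reds_erase_erase I j 0 1 (by decide) (by decide))
      have : l = 0 := by omega
      simp [this]
    · exact absurd ((h1 j).2 ha) (hid 0 (by decide))
    · have h0 := hid 0 (by decide)
      refine reply j 2 3 rfl (Or.inr rfl) (by decide) ((h2 j).1 ha) (fun l hl => ?_)
        (h.erase_inner h0) (reds_le_reds_erase_erase I j 2 3 (by decide) (by decide))
      have : l = 0 ∨ l = 1 ∨ l = 2 := by omega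
      rcases this with rfl | rfl | rfl
      exacts [by simp [h0], by simp [← h1, h0], by simp]
    · exact absurd ((h2 j).2 ha) (hid 2 (by decide))

end ChainCake

/-- The dot product in the plane. -/
def dot (p q : ℝ × ℝ) : ℝ := p.1 * q.1 + p.2 * q.2

/-- The cross product in the plane. -/
def cross (p q : ℝ × ℝ) : ℝ := p.1 * q.2 - p.2 * q.1

theorem cross_swap (p q : ℝ × ℝ) : cross q p = -cross p q := by
  unfold cross
  ring

theorem orientDet_swap (p q r : ℝ × ℝ) : orientDet q p r = -orientDet p q r := by
  unfold orientDet
  ring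

theorem orientDet_rotate (p q r : ℝ × ℝ) : orientDet q r p = orientDet p q r := by
  unfold orientDet
  ring

theorem exposed_of_forall_dot_lt {ι : Type} [DecidableEq ι] {P : ι → ℝ × ℝ} {I : Finset ι} {a : ι}
    (u : ℝ × ℝ) (h : ∀ b ∈ I, b ≠ a → dot u (P b) < dot u (P a)) : Exposed P I a := by
  have hlin : IsLinearMap ℝ (dot u) :=
    ⟨fun x y => by simp only [dot, Prod.fst_add, Prod.snd_add]; ring,
      fun c x => by simp only [dot, Prod.smul_fst, Prod.smul_snd, smul_eq_mul]; ring⟩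
  intro hmem
  have : convexHull ℝ (P '' (I.erase a : Finset ι)) ⊆ {q | dot u q < dot u (P a)} := by
    refine convexHull_min ?_ (convex_halfSpace_lt hlin _)
    rintro _ ⟨b, hb, rfl⟩
    rw [Finset.mem_coe, Finset.mem_erase] at hb
    exact h b hb.2 hb.1
  exact lt_irrefl (dot u (P a)) (this hmem)

theorem mem_convexHull_of_orientDet {s : Set (ℝ × ℝ)} {p p' x y u : ℝ × ℝ} (hp : p ∈ s)
    (hx : x ∈ s) (hy : y ∈ s) (hpx : 0 < orientDet p p' x) (hpy : orientDet p p' y < 0)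
    (h : dot u p' < dot u p) (hux : dot u x < dot u p') (huy : dot u y < dot u p') :
    p' ∈ convexHull ℝ s := by
  set a := orientDet p p' x with ha
  set b := -orientDet p p' y with hb
  set e := -orientDet p' x y with he
  have hb0 : 0 < b := neg_pos.2 hpy
  have key : e * (dot u p - dot u p') = b * (dot u p' - dot u x) + a * (dot u p' - dot u y) := by
    rw [ha, hb, he]
    unfold orientDet dot
    ring
  have he0 : 0 < e := by
    refine (mul_pos_iff_of_pos_right (sub_pos.2 h)).1 ?_
    rw [key]
    have := mul_pos hb0 (sub_pos.2 hux)
    have := mul_pos hpx (sub_pos.2 huy)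
    linarith
  have hs : 0 < e + b + a := by positivity
  have hmem := (convex_convexHull ℝ s).sum_mem (t := Finset.univ)
    (w := ![e / (e + b + a), b / (e + b + a), a / (e + b + a)]) (z := ![p, x, y])
    (fun i _ => by fin_cases i <;> simp <;> positivity)
    (by simp [Fin.sum_univ_three]; field_simp)
    (fun i _ => by fin_cases i <;> simp <;> apply subset_convexHull <;> assumption)
  convert hmem using 1
  simp only [Fin.sum_univ_three, Matrix.cons_val_zero, Matrix.cons_val_one, Matrix.cons_val]
  ext
  · simp only [Prod.fst_add, Prod.smul_fst, smul_eq_mul]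
    field_simp
    rw [ha, hb, he]
    unfold orientDet
    ring
  · simp only [Prod.snd_add, Prod.smul_snd, smul_eq_mul]
    field_simp
    rw [ha, hb, he]
    unfold orientDet
    ring

/-- The point at distance `x` along `v` and `y` perpendicular to it. -/
def frame (v : ℝ × ℝ) (x y : ℝ) : ℝ × ℝ := (x * v.1 - y * v.2, x * v.2 + y * v.1)

/-- The position along its ray of the `i`-th point of a chain. -/
def along (η : ℝ) (i : Fin 4) : ℝ := 1 - η * (i : ℕ)

/-- The offset from its ray of the `i`-th point of a chain. -/
def across (η : ℝ) (i : Fin 4) : ℝ := η ^ 3 * ((i : ℕ) * (8 - (i : ℕ)))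

/-- The `i`-th point of the chain along the ray `v`. -/
def chainPt (v : ℝ × ℝ) (η : ℝ) (i : Fin 4) : ℝ × ℝ := frame v (along η i) (across η i)

/-- A positive multiple of the vector from `chainPt v η a` to `chainPt v η b`. -/
def chainDir (v : ℝ × ℝ) (η : ℝ) (a b : Fin 4) : ℝ × ℝ :=
  frame v ((a : ℕ) - (b : ℕ)) (η ^ 2 * ((b : ℕ) * (8 - (b : ℕ)) - (a : ℕ) * (8 - (a : ℕ))))

/-- A linear functional separating the `a`-th point of the chain along `v` on its left side. -/
def leftDir (v : ℝ × ℝ) (η : ℝ) (a : Fin 4) : ℝ × ℝ := frame v ((8 - 2 * (a : ℕ)) * η ^ 2) 1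

/-- A linear functional separating the innermost point of the chain along `v` on its right side. -/
def rightDir (v : ℝ × ℝ) (η : ℝ) : ℝ × ℝ := frame v (-η) (-1)

theorem dot_frame_frame (v : ℝ × ℝ) (hv : v.1 ^ 2 + v.2 ^ 2 = 1) (x y x' y' : ℝ) :
    dot (frame v x y) (frame v x' y') = x * x' + y * y' := by
  unfold dot frame
  linear_combination (x * x' + y * y') * hv

theorem dot_frame (v : ℝ × ℝ) (hv : v.1 ^ 2 + v.2 ^ 2 = 1) (x y : ℝ) :
    dot v (frame v x y) = x := by
  unfold dot frame
  linear_combination x * hv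

theorem cross_frame_frame (v : ℝ × ℝ) (hv : v.1 ^ 2 + v.2 ^ 2 = 1) (x y x' y' : ℝ) :
    cross (frame v x y) (frame v x' y') = x * y' - y * x' := by
  unfold cross frame
  linear_combination (x * y' - y * x') * hv

theorem orientDet_chainPt_eq (v q : ℝ × ℝ) (η : ℝ) (a b : Fin 4) :
    orientDet (chainPt v η a) (chainPt v η b) q =
      η * cross (chainDir v η a b) (q - chainPt v η a) := by
  unfold orientDet cross chainDir chainPt frame along across
  simp only [Prod.fst_sub, Prod.snd_sub]
  ring

theorem chainPt_zero (v : ℝ × ℝ) (a : Fin 4) : chainPt v 0 a = v := by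
  simp [chainPt, frame, along, across]

/-- The parameter `η` is small enough for the chains along the rays `V`. -/
structure IsSmall {k : ℕ} (V : Fin k → ℝ × ℝ) (η : ℝ) : Prop where
  pos : 0 < η
  lt : 15 * η < 1
  cross_pos : ∀ i j a b, CCW i j → 0 < cross (chainPt (V i) η a) (chainPt (V j) η b)
  dir : ∀ i j a b e, i ≠ j → a < b →
    cross (chainDir (V i) η a b) (chainPt (V j) η e - chainPt (V i) η a) * cross (V i) (V j) < 0
  dot_lt : ∀ i j a b, i ≠ j → dot (V i) (chainPt (V j) η b) < along η a
  left : ∀ i j a b, i ≠ j → 0 < dot (leftDir (V i) η a) (chainPt (V j) η b) * cross (V i) (V j)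
  right : ∀ i j b, i ≠ j → (dot (rightDir (V i) η) (chainPt (V j) η b) -
    dot (rightDir (V i) η) (chainPt (V i) η 3)) * cross (V i) (V j) < 0
  three : ∀ i j l a b c, i ≠ j → i ≠ l → j ≠ l →
    orientDet (chainPt (V i) η a) (chainPt (V j) η b) (chainPt (V l) η c) ≠ 0

open Filter Topology in
theorem eventually_pos_of_continuous {F : ℝ → ℝ} (hF : Continuous F) (h : 0 < F 0) :
    ∀ᶠ η in 𝓝[>] (0 : ℝ), 0 < F η :=
  (hF.continuousAt.eventually (lt_mem_nhds h)).filter_mono nhdsWithin_le_nhds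

@[fun_prop]
theorem continuous_chainPt_fst (v : ℝ × ℝ) (a : Fin 4) :
    Continuous fun η => (chainPt v η a).1 := by
  unfold chainPt frame along across
  fun_prop

@[fun_prop]
theorem continuous_chainPt_snd (v : ℝ × ℝ) (a : Fin 4) :
    Continuous fun η => (chainPt v η a).2 := by
  unfold chainPt frame along across
  fun_prop

theorem cross_ne_zero {k : ℕ} {V : Fin k → ℝ × ℝ} (hS : ∀ i j, CCW i j → 0 < cross (V i) (V j))
    {i j : Fin k} (h : i ≠ j) : cross (V i) (V j) ≠ 0 := by
  rcases CCW.total h with hc | hc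
  · exact (hS _ _ hc).ne'
  · rw [cross_swap]
    exact (neg_neg_of_pos (hS _ _ hc)).ne

theorem orientDet_ne_zero_of_unit {p q r : ℝ × ℝ} (hp : p.1 ^ 2 + p.2 ^ 2 = 1)
    (hq : q.1 ^ 2 + q.2 ^ 2 = 1) (hr : r.1 ^ 2 + r.2 ^ 2 = 1) (hpq : p ≠ q) (hpr : p ≠ r)
    (hqr : q ≠ r) : orientDet p q r ≠ 0 := by
  obtain ⟨p₁, p₂⟩ := p
  obtain ⟨q₁, q₂⟩ := q
  obtain ⟨r₁, r₂⟩ := r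
  simp only at hp hq hr
  intro h
  simp only [orientDet] at h
  have hd : 0 < (q₁ - p₁) ^ 2 + (q₂ - p₂) ^ 2 := by
    refine lt_of_le_of_ne (by positivity) fun h0 => hpq ?_
    have h1 : q₁ - p₁ = 0 := by nlinarith [sq_nonneg (q₁ - p₁), sq_nonneg (q₂ - p₂)]
    have h2 : q₂ - p₂ = 0 := by nlinarith [sq_nonneg (q₁ - p₁), sq_nonneg (q₂ - p₂)]
    rw [sub_eq_zero.1 h1, sub_eq_zero.1 h2]
  obtain ⟨c, hc⟩ : ∃ c, c * ((q₁ - p₁) ^ 2 + (q₂ - p₂) ^ 2) =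
      (r₁ - p₁) * (q₁ - p₁) + (r₂ - p₂) * (q₂ - p₂) := ⟨_, div_mul_cancel₀ _ hd.ne'⟩
  have h1 : r₁ - p₁ = c * (q₁ - p₁) := by
    refine mul_right_cancel₀ hd.ne' ?_
    linear_combination -(q₁ - p₁) * hc - (q₂ - p₂) * h
  have h2 : r₂ - p₂ = c * (q₂ - p₂) := by
    refine mul_right_cancel₀ hd.ne' ?_
    linear_combination -(q₂ - p₂) * hc + (q₁ - p₁) * h
  obtain rfl : r₁ = p₁ + c * (q₁ - p₁) := by linarith
  obtain rfl : r₂ = p₂ + c * (q₂ - p₂) := by linarith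
  have h3 : c * (c - 1) * ((q₁ - p₁) ^ 2 + (q₂ - p₂) ^ 2) = 0 := by
    linear_combination hr - c * hq - (1 - c) * hp
  rcases mul_eq_zero.1 ((mul_eq_zero.1 h3).resolve_right hd.ne') with h0 | h0
  · exact hpr (by simp [h0])
  · exact hqr (by simp [sub_eq_zero.1 h0])

open Filter Topology in
theorem exists_isSmall {k : ℕ} {V : Fin k → ℝ × ℝ} (hV : ∀ j, (V j).1 ^ 2 + (V j).2 ^ 2 = 1)
    (hS : ∀ i j, CCW i j → 0 < cross (V i) (V j)) : ∃ η, IsSmall V η := by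
  have hne : ∀ {i j : Fin k}, i ≠ j → cross (V i) (V j) ≠ 0 := fun h => cross_ne_zero hS h
  have hinj : ∀ {i j : Fin k}, i ≠ j → V i ≠ V j := fun h e => hne h (by rw [e]; unfold cross; ring)
  have h1 : ∀ᶠ η in 𝓝[>] (0 : ℝ), 15 * η < 1 := by
    simpa using eventually_pos_of_continuous (F := fun η => 1 - 15 * η) (by fun_prop) (by simp)
  have h2 : ∀ᶠ η in 𝓝[>] (0 : ℝ), ∀ i j a b, CCW i j →
      0 < cross (chainPt (V i) η a) (chainPt (V j) η b) := by
    simp only [eventually_all]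
    intro i j a b h
    refine eventually_pos_of_continuous (by unfold cross; fun_prop) ?_
    simpa only [chainPt_zero] using hS _ _ h
  have h3 : ∀ᶠ η in 𝓝[>] (0 : ℝ), ∀ i j a b e, i ≠ j → a < b →
      0 < -(cross (chainDir (V i) η a b) (chainPt (V j) η e - chainPt (V i) η a) *
        cross (V i) (V j)) := by
    simp only [eventually_all]
    intro i j a b e h hab
    refine eventually_pos_of_continuous ?_ ?_
    · unfold cross chainDir frame
      simp only [Prod.fst_sub, Prod.snd_sub]
      fun_prop
    · have hab' : ((a : ℕ) : ℝ) < (b : ℕ) := by exact_mod_cast hab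
      have : -(cross (chainDir (V i) 0 a b) (V j - V i) * cross (V i) (V j)) =
          ((b : ℕ) - (a : ℕ)) * cross (V i) (V j) ^ 2 := by
        unfold cross chainDir frame
        simp only [Prod.fst_sub, Prod.snd_sub]
        ring
      rw [chainPt_zero, chainPt_zero, this]
      have := pow_pos (abs_pos.2 (hne h)) 2
      rw [sq_abs] at this
      exact mul_pos (sub_pos.2 hab') this
  have h4 : ∀ᶠ η in 𝓝[>] (0 : ℝ), ∀ i j a b, i ≠ j →
      0 < along η a - dot (V i) (chainPt (V j) η b) := by
    simp only [eventually_all]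
    intro i j a b h
    refine eventually_pos_of_continuous (by unfold dot along; fun_prop) ?_
    rw [chainPt_zero]
    have := pow_pos (abs_pos.2 (hne h)) 2
    rw [sq_abs] at this
    unfold cross at this
    unfold dot along
    simp only [zero_mul, sub_zero]
    nlinarith [hV i, hV j]
  have h5 : ∀ᶠ η in 𝓝[>] (0 : ℝ), ∀ i j a b, i ≠ j →
      0 < dot (leftDir (V i) η a) (chainPt (V j) η b) * cross (V i) (V j) := by
    simp only [eventually_all]
    intro i j a b h
    refine eventually_pos_of_continuous (by unfold dot leftDir frame; fun_prop) ?_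
    have : dot (leftDir (V i) 0 a) (V j) = cross (V i) (V j) := by
      unfold dot cross leftDir frame
      simp
      ring
    rw [chainPt_zero, this]
    exact mul_self_pos.2 (hne h)
  have h6 : ∀ᶠ η in 𝓝[>] (0 : ℝ), ∀ i j b, i ≠ j →
      0 < -((dot (rightDir (V i) η) (chainPt (V j) η b) -
        dot (rightDir (V i) η) (chainPt (V i) η 3)) * cross (V i) (V j)) := by
    simp only [eventually_all]
    intro i j b h
    refine eventually_pos_of_continuous (by unfold dot rightDir frame; fun_prop) ?_
    have : dot (rightDir (V i) 0) (V j) - dot (rightDir (V i) 0) (V i) = -cross (V i) (V j) := by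
      unfold dot cross rightDir frame
      simp
      ring
    rw [chainPt_zero, chainPt_zero, this, neg_mul, neg_neg]
    exact mul_self_pos.2 (hne h)
  have h7 : ∀ᶠ η in 𝓝[>] (0 : ℝ), ∀ i j l a b c, i ≠ j → i ≠ l → j ≠ l →
      0 < |orientDet (chainPt (V i) η a) (chainPt (V j) η b) (chainPt (V l) η c)| := by
    simp only [eventually_all]
    intro i j l a b c hij hil hjl
    refine eventually_pos_of_continuous (by unfold orientDet; fun_prop) ?_
    simp only [chainPt_zero]
    exact abs_pos.2 (orientDet_ne_zero_of_unit (hV i) (hV j) (hV l) (hinj hij) (hinj hil)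
      (hinj hjl))
  have h0 : ∀ᶠ η in 𝓝[>] (0 : ℝ), 0 < η := self_mem_nhdsWithin
  obtain ⟨η, h0, h1, h2, h3, h4, h5, h6, h7⟩ :=
    (h0.and (h1.and (h2.and (h3.and (h4.and (h5.and (h6.and h7))))))).exists
  exact ⟨η, h0, h1, h2, fun i j a b e h hab => neg_pos.1 (h3 i j a b e h hab),
    fun i j a b h => sub_pos.1 (h4 i j a b h), h5, fun i j b h => neg_pos.1 (h6 i j b h),
    fun i j l a b c hij hil hjl => abs_pos.1 (h7 i j l a b c hij hil hjl)⟩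

/-- The points of the cake: the chains along the rays `V` and the centre. -/
def cakePt {k : ℕ} (V : Fin k → ℝ × ℝ) (η : ℝ) : Idx k → ℝ × ℝ
  | none => 0
  | some (j, i) => chainPt (V j) η i

theorem natCast_le_three (i : Fin 4) : ((i : ℕ) : ℝ) ≤ 3 := by
  exact_mod_cast Nat.le_of_lt_succ i.2

theorem dot_zero_right (u : ℝ × ℝ) : dot u 0 = 0 := by
  simp [dot]

theorem cross_chainPt_pos {v : ℝ × ℝ} (hv : v.1 ^ 2 + v.2 ^ 2 = 1) {η : ℝ} (hη : 0 < η)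
    {a b : Fin 4} (hab : a < b) : 0 < cross (chainPt v η a) (chainPt v η b) := by
  have hab' : ((a : ℕ) : ℝ) + 1 ≤ (b : ℕ) := by exact_mod_cast hab
  have ha : (0 : ℝ) ≤ (a : ℕ) := by positivity
  have hb := natCast_le_three b
  rw [chainPt, chainPt, cross_frame_frame v hv]
  have : along η a * across η b - across η a * along η b =
      η ^ 3 * (((b : ℕ) - (a : ℕ)) * (8 - (a : ℕ) - (b : ℕ) + η * ((a : ℕ) * (b : ℕ)))) := by
    unfold along across
    ring
  rw [this]
  have h1 : 0 ≤ η * ((a : ℕ) * (b : ℕ) : ℝ) := by positivity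
  exact mul_pos (pow_pos hη 3) (mul_pos (by linarith) (by linarith))

theorem orientDet_chainPt_ne_zero {v : ℝ × ℝ} (hv : v.1 ^ 2 + v.2 ^ 2 = 1) {η : ℝ} (hη : 0 < η)
    {a b c : Fin 4} (hab : a ≠ b) (hac : a ≠ c) (hbc : b ≠ c) :
    orientDet (chainPt v η a) (chainPt v η b) (chainPt v η c) ≠ 0 := by
  have key : orientDet (chainPt v η a) (chainPt v η b) (chainPt v η c) =
      η ^ 4 * (((a : ℕ) - (b : ℕ)) * ((a : ℕ) - (c : ℕ)) * ((c : ℕ) - (b : ℕ))) := by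
    unfold orientDet chainPt frame along across
    linear_combination
      η ^ 4 * (((a : ℕ) - (b : ℕ)) * ((a : ℕ) - (c : ℕ)) * ((c : ℕ) - (b : ℕ))) * hv
  have cast_ne : ∀ {i j : Fin 4}, i ≠ j → ((i : ℕ) : ℝ) - (j : ℕ) ≠ 0 := fun hij =>
    sub_ne_zero.2 fun e => hij (Fin.ext (by exact_mod_cast e))
  rw [key]
  exact mul_ne_zero (pow_ne_zero _ hη.ne')
    (mul_ne_zero (mul_ne_zero (cast_ne hab) (cast_ne hac)) (cast_ne hbc.symm))

namespace IsSmall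

variable {k : ℕ} {V : Fin k → ℝ × ℝ} {η : ℝ}

theorem cross_ne_zero (h : IsSmall V η) (hV : ∀ j, (V j).1 ^ 2 + (V j).2 ^ 2 = 1)
    {x y : Fin k × Fin 4} (hxy : x ≠ y) :
    cross (cakePt V η (some x)) (cakePt V η (some y)) ≠ 0 := by
  obtain ⟨i, a⟩ := x
  obtain ⟨j, b⟩ := y
  by_cases hij : i = j
  · subst hij
    rcases lt_trichotomy a b with hab | hab | hab
    · exact (cross_chainPt_pos (hV i) h.pos hab).ne'
    · exact absurd (by rw [hab]) hxy
    · rw [cross_swap]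
      exact (neg_neg_of_pos (cross_chainPt_pos (hV i) h.pos hab)).ne
  · rcases CCW.total hij with hc | hc
    · exact (h.cross_pos i j a b hc).ne'
    · rw [cross_swap]
      exact (neg_neg_of_pos (h.cross_pos j i b a hc)).ne

theorem along_pos (h : IsSmall V η) (a : Fin 4) : 0 < along η a := by
  have := natCast_le_three a
  have := h.pos
  have := h.lt
  unfold along
  nlinarith

theorem along_lt (h : IsSmall V η) {a b : Fin 4} (hab : a < b) : along η b < along η a := by
  have hab' : ((a : ℕ) : ℝ) < (b : ℕ) := by exact_mod_cast hab
  exact sub_lt_sub_left (mul_lt_mul_of_pos_left hab' h.pos) _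

theorem orientDet_mul_neg (h : IsSmall V η) {i j : Fin k} {a b e : Fin 4} (hij : i ≠ j)
    (hab : a < b) :
    orientDet (chainPt (V i) η a) (chainPt (V i) η b) (chainPt (V j) η e) *
      cross (V i) (V j) < 0 := by
  rw [orientDet_chainPt_eq, mul_assoc]
  exact mul_neg_of_pos_of_neg h.pos (h.dir i j a b e hij hab)

theorem orientDet_ne_zero_of_ne (h : IsSmall V η) {i j : Fin k} {a b e : Fin 4} (hij : i ≠ j)
    (hab : a ≠ b) :
    orientDet (chainPt (V i) η a) (chainPt (V i) η b) (chainPt (V j) η e) ≠ 0 := by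
  rcases lt_or_gt_of_ne hab with hab | hab
  · exact left_ne_zero_of_mul (h.orientDet_mul_neg hij hab).ne
  · rw [orientDet_swap, neg_ne_zero]
    exact left_ne_zero_of_mul (h.orientDet_mul_neg hij hab).ne

theorem orientDet_cakePt_some_ne_zero (h : IsSmall V η)
    (hV : ∀ j, (V j).1 ^ 2 + (V j).2 ^ 2 = 1) {x y z : Fin k × Fin 4} (hxy : x ≠ y)
    (hxz : x ≠ z) (hyz : y ≠ z) :
    orientDet (cakePt V η (some x)) (cakePt V η (some y)) (cakePt V η (some z)) ≠ 0 := by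
  obtain ⟨i, a⟩ := x
  obtain ⟨j, b⟩ := y
  obtain ⟨l, c⟩ := z
  by_cases hij : i = j
  · subst hij
    have hab : a ≠ b := fun e => hxy (by rw [e])
    by_cases hil : i = l
    · subst hil
      exact orientDet_chainPt_ne_zero (hV i) h.pos hab (fun e => hxz (by rw [e]))
        (fun e => hyz (by rw [e]))
    · exact h.orientDet_ne_zero_of_ne hil hab
  · by_cases hil : i = l
    · subst hil
      have hac : a ≠ c := fun e => hxz (by rw [e])
      rw [← orientDet_rotate, ← orientDet_rotate]
      exact h.orientDet_ne_zero_of_ne hij hac.symm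
    · by_cases hjl : j = l
      · subst hjl
        have hbc : b ≠ c := fun e => hyz (by rw [e])
        rw [← orientDet_rotate]
        exact h.orientDet_ne_zero_of_ne (Ne.symm hij) hbc
      · exact h.three i j l a b c hij hil hjl

theorem orientDet_cakePt_none_ne_zero (h : IsSmall V η)
    (hV : ∀ j, (V j).1 ^ 2 + (V j).2 ^ 2 = 1) {x y : Fin k × Fin 4} (hxy : x ≠ y) :
    orientDet (cakePt V η none) (cakePt V η (some x)) (cakePt V η (some y)) ≠ 0 := by
  have : orientDet (cakePt V η none) (cakePt V η (some x)) (cakePt V η (some y)) =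
      cross (cakePt V η (some x)) (cakePt V η (some y)) := by
    simp [orientDet, cross, cakePt]
  rw [this]
  exact h.cross_ne_zero hV hxy

theorem orientDet_cakePt_ne_zero (h : IsSmall V η) (hV : ∀ j, (V j).1 ^ 2 + (V j).2 ^ 2 = 1)
    (x y z : Idx k) (hxy : x ≠ y) (hxz : x ≠ z) (hyz : y ≠ z) :
    orientDet (cakePt V η x) (cakePt V η y) (cakePt V η z) ≠ 0 := by
  match x, y, z with
  | none, none, _ => exact absurd rfl hxy
  | none, some _, none => exact absurd rfl hxz
  | some _, none, none => exact absurd rfl hyz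
  | none, some y, some z => exact h.orientDet_cakePt_none_ne_zero hV (fun e => hyz (by rw [e]))
  | some x, none, some z =>
    rw [← orientDet_rotate]
    exact h.orientDet_cakePt_none_ne_zero hV (fun e => hxz (by rw [e]))
  | some x, some y, none =>
    rw [← orientDet_rotate, ← orientDet_rotate]
    exact h.orientDet_cakePt_none_ne_zero hV (fun e => hxy (by rw [e]))
  | some x, some y, some z =>
    exact h.orientDet_cakePt_some_ne_zero hV (fun e => hxy (by rw [e])) (fun e => hxz (by rw [e]))
      (fun e => hyz (by rw [e]))

theorem injective_cakePt (h : IsSmall V η) (hV : ∀ j, (V j).1 ^ 2 + (V j).2 ^ 2 = 1) :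
    Function.Injective (cakePt V η) := by
  have hne : ∀ x, cakePt V η (some x) ≠ 0 := by
    rintro ⟨j, i⟩ e
    have := h.along_pos i
    rw [← dot_frame (V j) (hV j) (along η i) (across η i)] at this
    rw [show frame (V j) (along η i) (across η i) = 0 from e, dot_zero_right] at this
    exact lt_irrefl _ this
  rintro (_ | x) (_ | y) e
  · rfl
  · exact absurd e.symm (hne y)
  · exact absurd e (hne x)
  · by_contra hxy
    refine h.cross_ne_zero hV (x := x) (y := y) (fun e' => hxy (by rw [e'])) ?_
    rw [e]
    unfold cross
    ring

theorem dot_lt_along (h : IsSmall V η) (hV : ∀ j, (V j).1 ^ 2 + (V j).2 ^ 2 = 1) {j : Fin k}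
    {i : Fin 4} {x : Idx k} (hx : ∀ i' ≤ i, x ≠ some (j, i')) :
    dot (V j) (cakePt V η x) < along η i := by
  match x with
  | none =>
    rw [cakePt, dot_zero_right]
    exact h.along_pos i
  | some (l, b) =>
    by_cases hl : l = j
    · subst hl
      rw [cakePt, chainPt, dot_frame _ (hV l)]
      exact h.along_lt (not_le.1 fun hb => hx b hb rfl)
    · exact h.dot_lt j l i b (Ne.symm hl)

theorem exposed_top (h : IsSmall V η) (hV : ∀ j, (V j).1 ^ 2 + (V j).2 ^ 2 = 1)
    (I : Finset (Idx k)) (j : Fin k) (i : Fin 4) (hi : ∀ i' < i, some (j, i') ∉ I) :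
    Exposed (cakePt V η) I (some (j, i)) := by
  refine exposed_of_forall_dot_lt (V j) fun x hx hne => ?_
  rw [show dot (V j) (cakePt V η (some (j, i))) = along η i from dot_frame _ (hV j) _ _]
  refine h.dot_lt_along hV fun i' hi' e => ?_
  rcases hi'.lt_or_eq with hlt | heq
  · exact hi i' hlt (e ▸ hx)
  · exact hne (by rw [e, heq])

theorem exposed_left (h : IsSmall V η) (hV : ∀ j, (V j).1 ^ 2 + (V j).2 ^ 2 = 1)
    (hS : ∀ i j, CCW i j → 0 < cross (V i) (V j))
    (I : Finset (Idx k)) (j : Fin k) (i : Fin 4) (hI : ∀ j', Occ I j' → j' ≠ j → CCW j' j) :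
    Exposed (cakePt V η) I (some (j, i)) := by
  have hη := h.pos
  have hi := natCast_le_three i
  have hdot : ∀ b, dot (leftDir (V j) η i) (cakePt V η (some (j, b))) =
      (8 - 2 * (i : ℕ)) * η ^ 2 + η ^ 3 * ((i : ℕ) ^ 2 - ((i : ℕ) - (b : ℕ)) ^ 2) := by
    intro b
    rw [cakePt, leftDir, chainPt, dot_frame_frame _ (hV j)]
    unfold along across
    ring
  have hpos : 0 < dot (leftDir (V j) η i) (cakePt V η (some (j, i))) := by
    rw [hdot, sub_self]
    have : 0 < (8 - 2 * (i : ℕ)) * η ^ 2 := mul_pos (by linarith) (pow_pos hη 2)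
    have : 0 ≤ η ^ 3 * (((i : ℕ) : ℝ) ^ 2 - 0 ^ 2) := by
      rw [zero_pow two_ne_zero, sub_zero]
      positivity
    linarith
  refine exposed_of_forall_dot_lt (leftDir (V j) η i) fun x hx hne => ?_
  match x with
  | none => rwa [cakePt, dot_zero_right]
  | some (l, b) =>
    by_cases hl : l = j
    · subst hl
      have hib : ((i : ℕ) : ℝ) - (b : ℕ) ≠ 0 :=
        sub_ne_zero.2 fun e => hne (by rw [Fin.ext (by exact_mod_cast e : (i : ℕ) = b)])
      rw [hdot, hdot, sub_self, zero_pow two_ne_zero]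
      have := mul_pos (pow_pos hη 3) (pow_pos (abs_pos.2 hib) 2)
      rw [sq_abs] at this
      linarith
    · refine lt_trans ?_ hpos
      have hc : cross (V j) (V l) < 0 := by
        rw [cross_swap]
        exact neg_neg_of_pos (hS _ _ (hI l ⟨b, hx⟩ hl))
      exact neg_of_mul_pos_left (h.left j l i b (Ne.symm hl)) hc.le

theorem exposed_right (h : IsSmall V η) (hV : ∀ j, (V j).1 ^ 2 + (V j).2 ^ 2 = 1)
    (hS : ∀ i j, CCW i j → 0 < cross (V i) (V j))
    (I : Finset (Idx k)) (j : Fin k) (hI0 : none ∉ I) (hI : ∀ j', Occ I j' → j' ≠ j → CCW j j') :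
    Exposed (cakePt V η) I (some (j, 3)) := by
  have hη := h.pos
  have hη' := h.lt
  have hdot : ∀ b, dot (rightDir (V j) η) (cakePt V η (some (j, b))) =
      -η + η ^ 2 * ((b : ℕ) - η * ((b : ℕ) * (8 - (b : ℕ)))) := by
    intro b
    rw [cakePt, rightDir, chainPt, dot_frame_frame _ (hV j)]
    unfold along across
    ring
  refine exposed_of_forall_dot_lt (rightDir (V j) η) fun x hx hne => ?_
  match x with
  | none => exact absurd hx hI0
  | some (l, b) =>
    by_cases hl : l = j
    · subst hl
      have hb3 : b < 3 := lt_of_le_of_ne (Fin.le_last b) fun e => hne (by rw [e])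
      have hb : ((b : ℕ) : ℝ) + 1 ≤ 3 := by exact_mod_cast hb3
      rw [hdot, hdot, show (((3 : Fin 4) : ℕ) : ℝ) = 3 by norm_num]
      refine add_lt_add_right (mul_lt_mul_of_pos_left ?_ (pow_pos hη 2)) _
      have : 0 ≤ η * (((b : ℕ) : ℝ) * (8 - (b : ℕ))) :=
        mul_nonneg hη.le (mul_nonneg (Nat.cast_nonneg _) (by linarith))
      linarith
    · exact sub_neg.1 (neg_of_mul_neg_left (h.right j l b (Ne.symm hl))
        (hS _ _ (hI l ⟨b, hx⟩ hl)).le)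

theorem not_exposed (h : IsSmall V η) (hV : ∀ j, (V j).1 ^ 2 + (V j).2 ^ 2 = 1)
    (hS : ∀ i j, CCW i j → 0 < cross (V i) (V j))
    (I : Finset (Idx k)) (j : Fin k) (i i' : Fin 4) (j' : Fin k) (hii' : i < i')
    (hi : some (j, i) ∈ I) (hj' : Occ I j') (hjj' : CCW j j')
    (hI : none ∈ I ∨ ∃ j'', Occ I j'' ∧ CCW j'' j) :
    ¬ Exposed (cakePt V η) I (some (j, i')) := by
  have hmem : ∀ x ∈ I, x ≠ some (j, i') →
      cakePt V η x ∈ cakePt V η '' (I.erase (some (j, i')) : Finset (Idx k)) := fun x hx hne =>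
    Set.mem_image_of_mem _ (Finset.mem_coe.2 (Finset.mem_erase.2 ⟨hne, hx⟩))
  have hdot : ∀ b, dot (V j) (cakePt V η (some (j, b))) = along η b := fun b =>
    dot_frame _ (hV j) _ _
  obtain ⟨x, hxI, hxj, hx⟩ : ∃ x ∈ I, (∀ b, x ≠ some (j, b)) ∧
      0 < orientDet (cakePt V η (some (j, i))) (cakePt V η (some (j, i'))) (cakePt V η x) := by
    rcases hI with h0 | ⟨l, ⟨b, hb⟩, hlj⟩
    · refine ⟨none, h0, by simp, ?_⟩
      rw [← orientDet_rotate, ← orientDet_rotate]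
      have := cross_chainPt_pos (hV j) h.pos hii'
      simpa [orientDet, cross, cakePt] using this
    · refine ⟨_, hb, by simp [hlj.ne], ?_⟩
      have hc : cross (V j) (V l) < 0 := by
        rw [cross_swap]
        exact neg_neg_of_pos (hS _ _ hlj)
      exact pos_of_mul_neg_left (h.orientDet_mul_neg hlj.ne.symm hii') hc.le
  obtain ⟨b, hb⟩ := hj'
  have hbj : ∀ c, some (j', b) ≠ some (j, c) := by simp [hjj'.ne.symm]
  refine not_not.2 (mem_convexHull_of_orientDet (hmem _ hi (by simp [hii'.ne]))
    (hmem x hxI (hxj _)) (hmem _ hb (hbj _)) hx ?_ (u := V j) ?_ ?_ ?_)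
  · exact neg_of_mul_neg_left (h.orientDet_mul_neg hjj'.ne hii') (hS _ _ hjj').le
  · rw [hdot, hdot]
    exact h.along_lt hii'
  · rw [hdot]
    exact h.dot_lt_along hV fun c _ => hxj c
  · rw [hdot]
    exact h.dot_lt_along hV fun c _ => hbj c

theorem not_exposed_none (h : IsSmall V η)
    (I : Finset (Idx k)) (hne : ∃ j, Occ I j) (hI : ∀ j, Occ I j → ∃ j', Occ I j' ∧ CCW j j') :
    ¬ Exposed (cakePt V η) I none := by
  set s := cakePt V η '' (I.erase none : Finset (Idx k)) with hs
  intro hexp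
  obtain ⟨f, u, hu0, hu⟩ := geometric_hahn_banach_point_closed (convex_convexHull ℝ s)
    (((Finset.finite_toSet _).image _).isClosed_convexHull (𝕜 := ℝ)) hexp
  have hf : ∀ x : Fin k × Fin 4, some x ∈ I → 0 < f (cakePt V η (some x)) := by
    intro x hx
    have h0 : f 0 < u := hu0
    rw [map_zero] at h0
    exact h0.trans (hu _ (subset_convexHull ℝ s ⟨some x, by simpa using hx, rfl⟩))
  have hfp : ∀ p : ℝ × ℝ, f p = f (1, 0) * p.1 + f (0, 1) * p.2 := by
    intro p
    have : p = p.1 • ((1, 0) : ℝ × ℝ) + p.2 • ((0, 1) : ℝ × ℝ) := by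
      ext <;> simp
    conv_lhs => rw [this]
    rw [map_add, map_smul, map_smul, smul_eq_mul, smul_eq_mul]
    ring
  set g : ℝ × ℝ → ℝ := fun p => f (1, 0) * p.2 - f (0, 1) * p.1 with hg
  obtain ⟨j₀, i₀, h₀⟩ := hne
  obtain ⟨⟨j, i⟩, hji, hmax⟩ := Finset.exists_max_image
    (Finset.univ.filter fun x : Fin k × Fin 4 => some x ∈ I)
    (fun x => g (cakePt V η (some x)) / f (cakePt V η (some x))) ⟨(j₀, i₀), by simpa using h₀⟩
  simp only [Finset.mem_filter, Finset.mem_univ, true_and] at hji hmax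
  obtain ⟨l, ⟨b, hb⟩, hjl⟩ := hI j ⟨i, hji⟩
  have h1 := hf _ hji
  have h2 := hf _ hb
  have h3 := (div_le_div_iff₀ h2 h1).1 (hmax _ hb)
  have h4 : 0 < cross (cakePt V η (some (j, i))) (cakePt V η (some (l, b))) :=
    h.cross_pos j l i b hjl
  have h5 : (f (1, 0) ^ 2 + f (0, 1) ^ 2) *
      cross (cakePt V η (some (j, i))) (cakePt V η (some (l, b))) ≤ 0 := by
    rw [hfp (cakePt V η (some (j, i))), hfp (cakePt V η (some (l, b)))] at h3
    simp only [hg] at h3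
    unfold cross
    linarith
  have h6 : f (1, 0) ^ 2 + f (0, 1) ^ 2 = 0 :=
    le_antisymm (nonpos_of_mul_nonpos_left h5 h4) (by positivity)
  have h7 : f (1, 0) = 0 := by nlinarith [sq_nonneg (f (1, 0)), sq_nonneg (f (0, 1))]
  have h8 : f (0, 1) = 0 := by nlinarith [sq_nonneg (f (1, 0)), sq_nonneg (f (0, 1))]
  rw [hfp, h7, h8] at h1
  simp at h1

/-- The cake along the rays `V`. -/
def chainCake (h : IsSmall V η) (hV : ∀ j, (V j).1 ^ 2 + (V j).2 ^ 2 = 1)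
    (hS : ∀ i j, CCW i j → 0 < cross (V i) (V j)) : ChainCake k where
  P := cakePt V η
  inj := h.injective_cakePt hV
  genPos := h.orientDet_cakePt_ne_zero hV
  exposed_top := h.exposed_top hV
  exposed_left := h.exposed_left hV hS
  exposed_right := h.exposed_right hV hS
  hidden := h.not_exposed hV hS
  hidden_center := h.not_exposed_none

end IsSmall

/-- The rays used for the cake: the direction of every second one is reversed. -/
def ray {k : ℕ} (j : Fin k) : ℝ × ℝ :=
  ((-1) ^ j.1 * Real.cos (j.1 / k), (-1) ^ j.1 * Real.sin (j.1 / k))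

theorem ray_sq_add_sq {k : ℕ} (j : Fin k) : (ray j).1 ^ 2 + (ray j).2 ^ 2 = 1 := by
  have : (ray j).1 ^ 2 + (ray j).2 ^ 2 = ((-1) ^ 2) ^ j.1 *
      (Real.cos (j.1 / k) ^ 2 + Real.sin (j.1 / k) ^ 2) := by
    unfold ray
    rw [← pow_mul, mul_comm 2, pow_mul]
    ring
  rw [this, Real.cos_sq_add_sin_sq, neg_one_sq, one_pow, mul_one]

theorem cross_ray_pos {k : ℕ} (i j : Fin k) (h : CCW i j) : 0 < cross (ray i) (ray j) := by
  have key : cross (ray i) (ray j) = (-1) ^ (i.1 + j.1) * Real.sin ((j.1 : ℝ) / k - i.1 / k) := by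
    unfold cross ray
    rw [Real.sin_sub]
    ring
  have hk : (0 : ℝ) < k := by exact_mod_cast i.pos
  have hsin : ∀ i j : Fin k, i.1 < j.1 → 0 < Real.sin ((j.1 : ℝ) / k - i.1 / k) := by
    intro i j hij
    have hij' : (i.1 : ℝ) < j.1 := by exact_mod_cast hij
    have hj : (j.1 : ℝ) < k := by exact_mod_cast j.2
    have h1 : (i.1 : ℝ) / k < j.1 / k := by gcongr
    have h2 : (j.1 : ℝ) / k < 1 := (div_lt_one hk).2 hj
    have h3 : (0 : ℝ) ≤ i.1 / k := by positivity
    exact Real.sin_pos_of_pos_of_lt_pi (by linarith) (by linarith [Real.pi_gt_three])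
  rw [key]
  rcases h with ⟨hij, hpar⟩ | ⟨hji, hpar⟩
  · rw [Even.neg_one_pow (Nat.even_iff.2 hpar), one_mul]
    exact hsin i j hij
  · rw [Odd.neg_one_pow (Nat.odd_iff.2 hpar), ← neg_sub ((i.1 : ℝ) / k), Real.sin_neg]
    simpa using hsin j i hji

theorem ChainCake.nonempty (k : ℕ) : Nonempty (ChainCake k) := by
  obtain ⟨η, h⟩ := exists_isSmall (k := k) (V := ray) ray_sq_add_sq cross_ray_pos
  exact ⟨h.chainCake ray_sq_add_sq cross_ray_pos⟩

/-- For every odd `k > 2` there is a cake of `4k + 1` points, with exactly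
`2k` red and `2k + 1` green points, whose minimax result satisfies
`M(𝒮) ≥ (3k − 1)/2 = (3/4)·R(𝒮) − 1/2` (stated as `2·M(𝒮) ≥ 3k − 1`). -/
theorem statement4 (k : ℕ) (hodd : Odd k) (hk : 2 < k) :
    ∃ (S : Finset (ℝ × ℝ)) (w : ℝ × ℝ → ℕ),
      (∀ p, w p ≤ 1) ∧ GenPos (↑S : Set (ℝ × ℝ)) ∧
      S.card = 4 * k + 1 ∧
      (S.filter (fun p => w p = 1)).card = 2 * k ∧
      (S.filter (fun p => w p = 0)).card = 2 * k + 1 ∧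
      3 * k - 1 ≤ 2 * gameM w S := by
  obtain ⟨A⟩ := ChainCake.nonempty k
  have hcard : (Finset.univ.image A.P).card = 4 * k + 1 := by
    rw [Finset.card_image_of_injective _ A.inj, Finset.card_univ, Fintype.card_option,
      Fintype.card_prod, Fintype.card_fin, Fintype.card_fin, mul_comm]
  have hred : ((Finset.univ.image A.P).filter fun p => A.w p = 1).card = 2 * k := by
    have : (Finset.univ.image A.P).filter (fun p => A.w p = 1) =
        ((Finset.univ : Finset (Fin k)) ×ˢ ({1, 3} : Finset (Fin 4))).image
          fun a => A.P (some a) := by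
      ext p
      simp only [Finset.mem_filter, Finset.mem_image, Finset.mem_univ, true_and,
        Finset.mem_product, Finset.mem_insert, Finset.mem_singleton]
      constructor
      · rintro ⟨⟨a, rfl⟩, ha⟩
        rw [A.w_P] at ha
        match a with
        | none => simp [IsRed] at ha
        | some a => exact ⟨a, by_contra fun h => absurd ha (by simp [IsRed, h]), rfl⟩
      · rintro ⟨a, ha, rfl⟩
        refine ⟨⟨_, rfl⟩, ?_⟩
        rw [A.w_P, if_pos (show IsRed (some a) from ha)]
    rw [this, Finset.card_image_of_injective (f := fun a => A.P (some a)) _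
      (A.inj.comp (Option.some_injective _)),
      Finset.card_product, Finset.card_univ, Fintype.card_fin, Finset.card_pair (by decide),
      mul_comm]
  refine ⟨Finset.univ.image A.P, A.w, A.w_le_one, ?_, hcard, hred, ?_, ?_⟩
  · intro p hp q hq r hr hpq hpr hqr
    obtain ⟨x, -, rfl⟩ := Finset.mem_image.1 (Finset.mem_coe.1 hp)
    obtain ⟨y, -, rfl⟩ := Finset.mem_image.1 (Finset.mem_coe.1 hq)
    obtain ⟨z, -, rfl⟩ := Finset.mem_image.1 (Finset.mem_coe.1 hr)
    exact A.genPos x y z (fun e => hpq (by rw [e])) (fun e => hpr (by rw [e]))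
      (fun e => hqr (by rw [e]))
  · have := Finset.card_filter_add_card_filter_not (s := Finset.univ.image A.P)
      (fun p => A.w p = 1)
    have hw : ∀ p, ¬ A.w p = 1 ↔ A.w p = 0 := fun p => by
      have := A.w_le_one p
      omega
    simp only [hw] at this
    omega
  · have h := A.reds_le_val_add hodd Finset.univ ⟨by simp, by simp, by simp, by simp⟩
    have hreds : ChainCake.reds (Finset.univ : Finset (Idx k)) = k + k := by
      simp [ChainCake.reds]
    rw [hreds, ChainCake.val] at h
    obtain ⟨m, rfl⟩ := hodd
    omega

end
end
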